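/- Let n ≥ 1 and let ξ ∈ F_q((T^{-1})) be not algebraic of degree at most n. Then w_n^*(ξ) ≥ ŵ_n^@(ξ) ≥ w_n(ξ) / (w_n(ξ) − n + 1). -/

import Mathlib

open Polynomial
open scoped Classical

namespace MahlerKoksmaFq

noncomputable section

variable (Fq : Type) [Field Fq] [Fintype Fq]

/-- `K Fq` models `F_q((T⁻¹))`: Laurent series in the variable `t = T⁻¹`. -/
abbrev K := LaurentSeries Fq

/-- The element `T` (the inverse of the Laurent-series variable `t = T⁻¹`). -/
def Tvar : K Fq := HahnSeries.single (-1 : ℤ) 1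

/-- The absolute value `|ξ| = q^{-ν(ξ)}` on `F_q((T⁻¹))`. -/
def absK (ξ : K Fq) : ℝ :=
  if ξ = 0 then 0 else (Fintype.card Fq : ℝ) ^ (-(HahnSeries.order ξ))

/-- The embedding of `F_q[T]` into `F_q((T⁻¹))`, sending `T` to `Tvar`. -/
def emb : Polynomial Fq →+* K Fq :=
  Polynomial.eval₂RingHom (algebraMap Fq (K Fq)) (Tvar Fq)

/-- Evaluation of `P ∈ F_q[T][X]` at `ξ ∈ F_q((T⁻¹))`. -/
def evalK (P : Polynomial (Polynomial Fq)) (ξ : K Fq) : K Fq :=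
  P.eval₂ (emb Fq) ξ

/-- Height of a polynomial over `F_q[T]`: the maximum of the absolute values
`q^{deg c}` of its coefficients. -/
def HP (P : Polynomial (Polynomial Fq)) : ℝ :=
  (Fintype.card Fq : ℝ) ^ (P.support.sup fun i => (P.coeff i).natDegree)

/-- `ξ` is algebraic (over `F_q[T]`) of degree at most `n`. -/
def IsAlgDegLe (ξ : K Fq) (n : ℕ) : Prop :=
  ∃ P : Polynomial (Polynomial Fq), P ≠ 0 ∧ P.natDegree ≤ n ∧ evalK Fq P ξ = 0

/-- `ξ` is algebraic over `F_q[T]`. -/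
def IsAlgK (ξ : K Fq) : Prop :=
  ∃ P : Polynomial (Polynomial Fq), P ≠ 0 ∧ evalK Fq P ξ = 0

/-- The degree of an algebraic element of `F_q((T⁻¹))`. -/
def degA (α : K Fq) : ℕ :=
  sInf {d | ∃ P : Polynomial (Polynomial Fq), P ≠ 0 ∧ P.natDegree = d ∧ evalK Fq P α = 0}

/-- The height of an algebraic element `α` of `F_q((T⁻¹))`: the least height of a
 nonzero annihilating polynomial of minimal degree (= height of the minimal
 defining polynomial over `F_q[T]`). -/
def HA (α : K Fq) : ℝ :=
  sInf {h | ∃ P : Polynomial (Polynomial Fq),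
    P ≠ 0 ∧ P.natDegree = degA Fq α ∧ evalK Fq P α = 0 ∧ h = HP Fq P}

/-- The defining set for Mahler's exponent `w_n`. -/
def wnSet (ξ : K Fq) (n : ℕ) : Set ℝ :=
  {w | {P : Polynomial (Polynomial Fq) |
      P.natDegree ≤ n ∧ 0 < absK Fq (evalK Fq P ξ) ∧
      absK Fq (evalK Fq P ξ) < HP Fq P ^ (-w)}.Infinite}

/-- Mahler's exponent `w_n(ξ)`. -/
def wn (ξ : K Fq) (n : ℕ) : EReal :=
  sSup ((fun w : ℝ => (w : EReal)) '' wnSet Fq ξ n)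

/-- The defining set for `w_n^{sep}` (separable polynomials only). -/
def wnsepSet (ξ : K Fq) (n : ℕ) : Set ℝ :=
  {w | {P : Polynomial (Polynomial Fq) |
      P.Separable ∧ P.natDegree ≤ n ∧ 0 < absK Fq (evalK Fq P ξ) ∧
      absK Fq (evalK Fq P ξ) < HP Fq P ^ (-w)}.Infinite}

/-- The exponent `w_n^{sep}(ξ)`. -/
def wnsep (ξ : K Fq) (n : ℕ) : EReal :=
  sSup ((fun w : ℝ => (w : EReal)) '' wnsepSet Fq ξ n)

/-- The defining set for Koksma's exponent `w_n^*` (approximation by algebraic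
elements lying in `F_q((T⁻¹))`). -/
def wnstarSet (ξ : K Fq) (n : ℕ) : Set ℝ :=
  {w | {α : K Fq | IsAlgK Fq α ∧ degA Fq α ≤ n ∧ 0 < absK Fq (ξ - α) ∧
      absK Fq (ξ - α) < HA Fq α ^ (-w - 1)}.Infinite}

/-- Koksma's exponent `w_n^*(ξ)`. -/
def wnstar (ξ : K Fq) (n : ℕ) : EReal :=
  sSup ((fun w : ℝ => (w : EReal)) '' wnstarSet Fq ξ n)

/-- The defining set for the uniform exponent `ŵ_n`. -/
def hwnSet (ξ : K Fq) (n : ℕ) : Set ℝ :=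
  {w | ∃ H0 : ℝ, ∀ H : ℝ, H0 < H → ∃ P : Polynomial (Polynomial Fq),
      P.natDegree ≤ n ∧ HP Fq P ≤ H ∧ 0 < absK Fq (evalK Fq P ξ) ∧
      absK Fq (evalK Fq P ξ) < H ^ (-w)}

/-- The uniform exponent `ŵ_n(ξ)`. -/
def hwn (ξ : K Fq) (n : ℕ) : EReal :=
  sSup ((fun w : ℝ => (w : EReal)) '' hwnSet Fq ξ n)

/-- The defining set for the uniform exponent `ŵ_n^{sep}` (separable polynomials only). -/
def hwnsepSet (ξ : K Fq) (n : ℕ) : Set ℝ :=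
  {w | ∃ H0 : ℝ, ∀ H : ℝ, H0 < H → ∃ P : Polynomial (Polynomial Fq),
      P.Separable ∧ P.natDegree ≤ n ∧ HP Fq P ≤ H ∧ 0 < absK Fq (evalK Fq P ξ) ∧
      absK Fq (evalK Fq P ξ) < H ^ (-w)}

/-- The uniform exponent `ŵ_n^{sep}(ξ)`. -/
def hwnsep (ξ : K Fq) (n : ℕ) : EReal :=
  sSup ((fun w : ℝ => (w : EReal)) '' hwnsepSet Fq ξ n)

/-- The fractional part of a Laurent series in `T⁻¹`: the part with only
 negative powers of `T` (positive powers of the series variable `t = T⁻¹`). -/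
def fracPart (η : K Fq) : K Fq :=
  { coeff := fun m => if 0 < m then η.coeff m else 0
    isPWO_support' := η.isPWO_support'.mono (fun m hm => by
      by_cases h : 0 < m
      · simpa [Function.mem_support, h] using hm
      · simp [Function.mem_support, h] at hm) }

/-- The fractional-part norm `‖η‖ = |η - [η]|`. -/
def fracNorm (η : K Fq) : ℝ := absK Fq (fracPart Fq η)

/-- `max{‖R(T)ξ‖, …, ‖R(T)ξⁿ‖}`. -/
def maxFrac (ξ : K Fq) (n : ℕ) (R : Polynomial Fq) : ℝ :=
  sSup ((fun i => fracNorm Fq (emb Fq R * ξ ^ i)) '' Set.Icc 1 n)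

/-- The defining set for the exponent of simultaneous approximation `λ_n`. -/
def lamSet (ξ : K Fq) (n : ℕ) : Set ℝ :=
  {l | {R : Polynomial Fq | 0 < maxFrac Fq ξ n R ∧
      maxFrac Fq ξ n R < (Fintype.card Fq : ℝ) ^ (-(l * R.natDegree))}.Infinite}

/-- The exponent of simultaneous approximation `λ_n(ξ)`. -/
def lam (ξ : K Fq) (n : ℕ) : EReal :=
  sSup ((fun w : ℝ => (w : EReal)) '' lamSet Fq ξ n)

/-- The defining set for the uniform exponent `λ̂_n`. -/
def hlamSet (ξ : K Fq) (n : ℕ) : Set ℝ :=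
  {l | ∃ d0 : ℕ, ∀ d : ℕ, d0 < d → ∃ R : Polynomial Fq, R.natDegree ≤ d ∧
      0 < maxFrac Fq ξ n R ∧
      maxFrac Fq ξ n R < (Fintype.card Fq : ℝ) ^ (-(l * d))}

/-- The uniform exponent `λ̂_n(ξ)`. -/
def hlam (ξ : K Fq) (n : ℕ) : EReal :=
  sSup ((fun w : ℝ => (w : EReal)) '' hlamSet Fq ξ n)

/-- An algebraic closure of `F_q((T⁻¹))`; its algebraic elements are exactly the
algebraic elements of the completion `C_∞`. -/
abbrev Kbar := AlgebraicClosure (K Fq)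

/-- The embedding of `F_q[T]` into the algebraic closure. -/
def embbar : Polynomial Fq →+* Kbar Fq :=
  (algebraMap (K Fq) (Kbar Fq)).comp (emb Fq)

/-- Evaluation of `P ∈ F_q[T][X]` at a point of the algebraic closure. -/
def evalKbar (P : Polynomial (Polynomial Fq)) (x : Kbar Fq) : Kbar Fq :=
  P.eval₂ (embbar Fq) x

/-- The unique extension of the absolute value of `F_q((T⁻¹))` to its algebraic
closure: `|x| = |N(x)|^{1/d} = |a_0|^{1/d}` where `a_0` is the constant term and
`d` the degree of the minimal polynomial of `x` over `F_q((T⁻¹))`. -/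
def absC (x : Kbar Fq) : ℝ :=
  absK Fq ((minpoly (K Fq) x).coeff 0) ^ ((1 : ℝ) / (minpoly (K Fq) x).natDegree)

/-- `x ∈ C_∞` is algebraic over `F_q[T]`. -/
def IsAlgKbar (x : Kbar Fq) : Prop :=
  ∃ P : Polynomial (Polynomial Fq), P ≠ 0 ∧ evalKbar Fq P x = 0

/-- Degree over `F_q[T]` of an algebraic element of `C_∞`. -/
def degAbar (x : Kbar Fq) : ℕ :=
  sInf {d | ∃ P : Polynomial (Polynomial Fq), P ≠ 0 ∧ P.natDegree = d ∧ evalKbar Fq P x = 0}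

/-- Height of an algebraic element of `C_∞`. -/
def HAbar (x : Kbar Fq) : ℝ :=
  sInf {h | ∃ P : Polynomial (Polynomial Fq),
    P ≠ 0 ∧ P.natDegree = degAbar Fq x ∧ evalKbar Fq P x = 0 ∧ h = HP Fq P}

/-- The defining set for the exponent `w_n^@` (approximation by algebraic
elements of `C_∞`). -/
def wnAtSet (ξ : K Fq) (n : ℕ) : Set ℝ :=
  {w | {α : Kbar Fq | IsAlgKbar Fq α ∧ degAbar Fq α ≤ n ∧
      0 < absC Fq (algebraMap (K Fq) (Kbar Fq) ξ - α) ∧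
      absC Fq (algebraMap (K Fq) (Kbar Fq) ξ - α) < HAbar Fq α ^ (-w - 1)}.Infinite}

/-- The exponent `w_n^@(ξ)`. -/
def wnAt (ξ : K Fq) (n : ℕ) : EReal :=
  sSup ((fun w : ℝ => (w : EReal)) '' wnAtSet Fq ξ n)

/-- The defining set for the uniform exponent `ŵ_n^@`. -/
def hwnAtSet (ξ : K Fq) (n : ℕ) : Set ℝ :=
  {w | ∃ H0 : ℝ, ∀ H : ℝ, H0 < H → ∃ α : Kbar Fq, IsAlgKbar Fq α ∧ degAbar Fq α ≤ n ∧
      HAbar Fq α ≤ H ∧ 0 < absC Fq (algebraMap (K Fq) (Kbar Fq) ξ - α) ∧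
      absC Fq (algebraMap (K Fq) (Kbar Fq) ξ - α) < (HAbar Fq α)⁻¹ * H ^ (-w)}

/-- The uniform exponent `ŵ_n^@(ξ)`. -/
def hwnAt (ξ : K Fq) (n : ℕ) : EReal :=
  sSup ((fun w : ℝ => (w : EReal)) '' hwnAtSet Fq ξ n)

/-- `w(ξ) = limsup_n w_n(ξ)/n`. -/
def wlim (ξ : K Fq) : EReal :=
  Filter.atTop.limsup fun n : ℕ => wn Fq ξ n * (((n : ℝ)⁻¹ : ℝ) : EReal)

/-- `w^*(ξ) = limsup_n w_n^*(ξ)/n`. -/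
def wlimstar (ξ : K Fq) : EReal :=
  Filter.atTop.limsup fun n : ℕ => wnstar Fq ξ n * (((n : ℝ)⁻¹ : ℝ) : EReal)

/-- Height of a polynomial over `C_∞`: maximum of the absolute values of its
coefficients. -/
def HC (P : Polynomial (Kbar Fq)) : ℝ :=
  sSup ((fun i => absC Fq (P.coeff i)) '' Set.Iic P.natDegree)



/-! ### The absolute value on `K` -/

lemma card_gt_one : (1 : ℝ) < Fintype.card Fq := by
  exact_mod_cast Fintype.one_lt_card

lemma card_pos' : (0 : ℝ) < Fintype.card Fq := lt_trans one_pos (card_gt_one Fq)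

lemma absK_zero : absK Fq 0 = 0 := by simp [absK]

lemma absK_of_ne {x : K Fq} (hx : x ≠ 0) :
    absK Fq x = (Fintype.card Fq : ℝ) ^ (-(HahnSeries.order x)) := by simp [absK, hx]

lemma absK_pos {x : K Fq} (hx : x ≠ 0) : 0 < absK Fq x := by
  rw [absK_of_ne Fq hx]; exact zpow_pos (card_pos' Fq) _

lemma absK_nonneg (x : K Fq) : 0 ≤ absK Fq x := by
  by_cases hx : x = 0
  · simp [hx, absK_zero]
  · exact (absK_pos Fq hx).le

/-- `absK x ≤ q^(-N)` iff the coefficients below `N` vanish. -/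
lemma absK_le_iff (x : K Fq) (N : ℤ) :
    absK Fq x ≤ (Fintype.card Fq : ℝ) ^ (-N) ↔ ∀ j < N, x.coeff j = 0 := by
  by_cases hx : x = 0
  · subst hx
    simp [absK_zero, (zpow_pos (card_pos' Fq) N).le]
  · rw [absK_of_ne Fq hx, zpow_le_zpow_iff_right₀ (card_gt_one Fq), neg_le_neg_iff,
      HahnSeries.le_order_iff_forall hx]

lemma absK_add (x y : K Fq) : absK Fq (x + y) ≤ max (absK Fq x) (absK Fq y) := by
  by_cases hx : x = 0
  · simp [hx]
  by_cases hy : y = 0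
  · simp [hy]
  by_cases hxy : x + y = 0
  · rw [hxy, absK_zero]; exact le_max_of_le_left (absK_nonneg Fq x)
  have h := HahnSeries.min_order_le_order_add hxy
  rw [absK_of_ne Fq hx, absK_of_ne Fq hy, absK_of_ne Fq hxy]
  rcases min_le_iff.1 h with h | h
  · exact le_max_of_le_left (zpow_le_zpow_right₀ (card_gt_one Fq).le (by omega))
  · exact le_max_of_le_right (zpow_le_zpow_right₀ (card_gt_one Fq).le (by omega))

lemma absK_mul (x y : K Fq) : absK Fq (x * y) = absK Fq x * absK Fq y := by
  by_cases hx : x = 0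
  · simp [hx, absK_zero]
  by_cases hy : y = 0
  · simp [hy, absK_zero]
  rw [absK_of_ne Fq hx, absK_of_ne Fq hy, absK_of_ne Fq (mul_ne_zero hx hy),
    HahnSeries.order_mul hx hy, neg_add, zpow_add₀ (card_pos' Fq).ne']

/-- `absK` bundled as an absolute value. -/
def avK : AbsoluteValue (K Fq) ℝ where
  toFun := absK Fq
  map_mul' := absK_mul Fq
  nonneg' := absK_nonneg Fq
  eq_zero' x := by
    constructor
    · intro h; by_contra hx; exact (absK_pos Fq hx).ne' h
    · rintro rfl; exact absK_zero Fq
  add_le' x y := (absK_add Fq x y).trans (max_le_add_of_nonneg (absK_nonneg Fq x) (absK_nonneg Fq y))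

lemma avK_apply (x : K Fq) : avK Fq x = absK Fq x := rfl

lemma avK_nonarch : IsNonarchimedean (avK Fq) := absK_add Fq

/-- Extension of a complete nonarchimedean absolute value to the algebraic closure. -/
lemma exists_ext_aux {F : Type*} [Field F] (v : AbsoluteValue F ℝ) (hna : IsNonarchimedean v)
    (hnt : ∃ x, 1 < v x) (B : ℕ → ℝ) (hB : ∀ N, 0 < B N)
    (hc : ∀ u : ℕ → F, (∀ N n m, N ≤ n → N ≤ m → v (u n - u m) < B N) →
      ∃ x, Filter.Tendsto (fun n => v (u n - x)) Filter.atTop (nhds 0)) :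
    ∃ N : AbsoluteValue (AlgebraicClosure F) ℝ, IsNonarchimedean N ∧
      (∀ x, N (algebraMap F (AlgebraicClosure F) x) = v x) ∧
      ∀ x, N x = v ((minpoly F x).coeff 0) ^ ((1:ℝ) / (minpoly F x).natDegree) := by
  letI i1 : NormedField F := v.toNormedField
  letI i2 : NontriviallyNormedField F := { i1 with non_trivial := hnt }
  have hdist : ∀ x y : F, dist x y = v (x - y) := fun x y => by
    rw [dist_eq_norm]; rfl
  haveI : CompleteSpace F := by
    apply Metric.complete_of_convergent_controlled_sequences B hB
    intro u hu
    obtain ⟨x, hx⟩ := hc u (fun N n m h1 h2 => by rw [← hdist]; exact hu N n m h1 h2)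
    refine ⟨x, ?_⟩
    rw [tendsto_iff_dist_tendsto_zero]
    simpa only [hdist] using hx
  haveI : IsUltrametricDist F := IsUltrametricDist.isUltrametricDist_of_isNonarchimedean_norm hna
  let M := spectralMulAlgNorm F (AlgebraicClosure F)
  refine ⟨⟨⟨M, map_mul M⟩, fun x => apply_nonneg M x, fun x => map_eq_zero_iff_eq_zero M,
    fun x y => map_add_le_add M x y⟩, ?_, ?_, ?_⟩
  · exact isNonarchimedean_spectralNorm
  · intro x
    exact spectralNorm_extends x
  · intro x
    exact spectralNorm.spectralNorm_eq_norm_coeff_zero_rpow F (AlgebraicClosure F) x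

lemma complete_aux (u : ℕ → K Fq) (hu : ∀ N n m : ℕ, N ≤ n → N ≤ m →
      avK Fq (u n - u m) < (Fintype.card Fq : ℝ) ^ (-((N : ℤ) + 1))) :
      ∃ x, Filter.Tendsto (fun n => avK Fq (u n - x)) Filter.atTop (nhds 0) := by
  have hq := card_gt_one Fq
  have hq0 := card_pos' Fq
  have key : ∀ N n m : ℕ, N ≤ n → N ≤ m → ∀ j : ℤ, j ≤ N → (u n).coeff j = (u m).coeff j := by
    intro N n m hn hm j hj
    have h := (hu N n m hn hm).le
    rw [avK_apply, absK_le_iff] at h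
    have := h j (by omega)
    rwa [HahnSeries.coeff_sub, sub_eq_zero] at this
  have hbd : BddBelow (Function.support fun j : ℤ => (u j.toNat).coeff j) := by
    refine ⟨min 0 (u 0).order, ?_⟩
    intro j hj
    by_contra hlt
    rw [not_le, lt_min_iff] at hlt
    apply hj
    simp only
    rw [Int.toNat_of_nonpos hlt.1.le]
    exact HahnSeries.coeff_eq_zero_of_lt_order hlt.2
  refine ⟨HahnSeries.ofSuppBddBelow (fun j : ℤ => (u j.toNat).coeff j) hbd, ?_⟩
  have hto : Filter.Tendsto (fun N : ℕ => (Fintype.card Fq : ℝ)⁻¹ ^ N) Filter.atTop (nhds 0) :=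
    tendsto_pow_atTop_nhds_zero_of_lt_one (inv_nonneg.2 hq0.le) (inv_lt_one_of_one_lt₀ hq)
  refine squeeze_zero (fun _ => AbsoluteValue.nonneg _ _) (fun N => ?_) hto
  rw [avK_apply, inv_pow, ← zpow_natCast, ← zpow_neg, absK_le_iff]
  intro j hj
  rw [HahnSeries.coeff_sub, HahnSeries.coeff_ofSuppBddBelow, sub_eq_zero]
  exact key j.toNat N j.toNat (by omega) le_rfl j (by omega)

/-! ### The absolute value on `Kbar` -/

lemma absK_Tvar : absK Fq (Tvar Fq) = Fintype.card Fq := by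
  have h : Tvar Fq ≠ 0 := by simp [Tvar]
  rw [absK_of_ne Fq h, Tvar, HahnSeries.order_single one_ne_zero]
  simp

lemma exists_avC : ∃ N : AbsoluteValue (Kbar Fq) ℝ, IsNonarchimedean N ∧
    (∀ x : K Fq, N (algebraMap (K Fq) (Kbar Fq) x) = absK Fq x) ∧ (∀ x, N x = absC Fq x) :=
  exists_ext_aux (avK Fq) (avK_nonarch Fq)
    ⟨Tvar Fq, by rw [avK_apply, absK_Tvar]; exact card_gt_one Fq⟩
    (fun N : ℕ => (Fintype.card Fq : ℝ) ^ (-((N : ℤ) + 1)))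
    (fun N => zpow_pos (card_pos' Fq) _) (complete_aux Fq)

/-- `absC` bundled as an absolute value. -/
def avC : AbsoluteValue (Kbar Fq) ℝ := (exists_avC Fq).choose

lemma avC_nonarch : IsNonarchimedean (avC Fq) := (exists_avC Fq).choose_spec.1

lemma avC_algebraMap (x : K Fq) : avC Fq (algebraMap (K Fq) (Kbar Fq) x) = absK Fq x :=
  (exists_avC Fq).choose_spec.2.1 x

lemma avC_apply (x : Kbar Fq) : avC Fq x = absC Fq x := (exists_avC Fq).choose_spec.2.2 x

/-! ### The embedding of `F_q[T]` and heights -/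

lemma emb_coeff (a : Polynomial Fq) (j : ℤ) :
    (emb Fq a).coeff j = if j ≤ 0 then a.coeff (-j).toNat else 0 := by
  induction a using Polynomial.induction_on' with
  | add p r hp hr =>
    rw [map_add, HahnSeries.coeff_add, hp, hr]
    split_ifs <;> simp
  | monomial k c =>
    have h1 : emb Fq (monomial k c) = HahnSeries.single (-(k : ℤ)) c := by
      simp only [emb, coe_eval₂RingHom, eval₂_monomial, Tvar, HahnSeries.single_pow]
      have h2 : algebraMap Fq (K Fq) c = HahnSeries.single 0 c := by
        rw [HahnSeries.algebraMap_apply']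
        exact HahnSeries.ofPowerSeries_C c
      rw [h2, HahnSeries.single_mul_single]
      simp
    rw [h1, HahnSeries.coeff_single, coeff_monomial]
    by_cases hj : j ≤ 0
    · rw [if_pos hj]
      by_cases hk : j = -(k : ℤ)
      · rw [if_pos hk, if_pos (by omega)]
      · rw [if_neg hk, if_neg (by omega)]
    · rw [if_neg hj, if_neg (by omega)]

lemma absK_emb {a : Polynomial Fq} (ha : a ≠ 0) :
    absK Fq (emb Fq a) = (Fintype.card Fq : ℝ) ^ a.natDegree := by
  have hc : (emb Fq a).coeff (-(a.natDegree : ℤ)) ≠ 0 := by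
    rw [emb_coeff, if_pos (by omega)]
    simpa using ha
  have h0 : emb Fq a ≠ 0 := by
    intro h; rw [h] at hc; simp at hc
  have h1 : (emb Fq a).order = -(a.natDegree : ℤ) := by
    apply le_antisymm (HahnSeries.order_le_of_coeff_ne_zero hc)
    rw [HahnSeries.le_order_iff_forall h0]
    intro j hj
    rw [emb_coeff, if_pos (by omega)]
    exact coeff_eq_zero_of_natDegree_lt (by omega)
  rw [absK_of_ne Fq h0, h1]; simp

lemma emb_ne_zero {a : Polynomial Fq} (ha : a ≠ 0) : emb Fq a ≠ 0 := by
  intro h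
  have := absK_emb Fq ha
  rw [h, absK_zero] at this
  exact (pow_pos (card_pos' Fq) _).ne this

lemma emb_injective : Function.Injective (emb Fq) :=
  (injective_iff_map_eq_zero _).2 fun a h => by
    by_contra ha; exact emb_ne_zero Fq ha h

lemma one_le_absK_emb {a : Polynomial Fq} (ha : a ≠ 0) : 1 ≤ absK Fq (emb Fq a) := by
  rw [absK_emb Fq ha]; exact one_le_pow₀ (card_gt_one Fq).le

lemma embbar_injective : Function.Injective (embbar Fq) :=
  (algebraMap (K Fq) (Kbar Fq)).injective.comp (emb_injective Fq)

lemma HP_ge_one (P : Polynomial (Polynomial Fq)) : 1 ≤ HP Fq P :=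
  one_le_pow₀ (card_gt_one Fq).le

lemma HP_pos (P : Polynomial (Polynomial Fq)) : 0 < HP Fq P :=
  lt_of_lt_of_le one_pos (HP_ge_one Fq P)

lemma absK_coeff_le_HP (P : Polynomial (Polynomial Fq)) (i : ℕ) :
    absK Fq (emb Fq (P.coeff i)) ≤ HP Fq P := by
  by_cases h : P.coeff i = 0
  · rw [h, map_zero, absK_zero]; exact (HP_pos Fq P).le
  · rw [absK_emb Fq h]
    apply pow_le_pow_right₀ (card_gt_one Fq).le
    exact Finset.le_sup (f := fun i => (P.coeff i).natDegree) (mem_support_iff.2 h)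

lemma exists_absK_coeff_eq_HP {P : Polynomial (Polynomial Fq)} (hP : P ≠ 0) :
    ∃ i, P.coeff i ≠ 0 ∧ absK Fq (emb Fq (P.coeff i)) = HP Fq P := by
  obtain ⟨i, hi, h⟩ := Finset.exists_mem_eq_sup P.support (nonempty_support_iff.2 hP)
    (fun i => (P.coeff i).natDegree)
  refine ⟨i, mem_support_iff.1 hi, ?_⟩
  rw [absK_emb Fq (mem_support_iff.1 hi), HP, h]

lemma HP_le {P : Polynomial (Polynomial Fq)} (hP : P ≠ 0) {B : ℝ}
    (h : ∀ i, absK Fq (emb Fq (P.coeff i)) ≤ B) : HP Fq P ≤ B := by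
  obtain ⟨i, _, hi⟩ := exists_absK_coeff_eq_HP Fq hP
  rw [← hi]; exact h i

/-- The absolute value on `F_q[T]`. -/
def avT : AbsoluteValue (Polynomial Fq) ℝ := (avK Fq).comp (emb_injective Fq)

lemma avT_apply (a : Polynomial Fq) : avT Fq a = absK Fq (emb Fq a) := rfl

lemma avT_nonarch : IsNonarchimedean (avT Fq) := fun x y => by
  rw [avT_apply, map_add]; exact absK_add Fq _ _

lemma HP_eq_gauss {P : Polynomial (Polynomial Fq)} (hP : P ≠ 0) :
    HP Fq P = P.gaussNorm (avT Fq) 1 := by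
  apply le_antisymm
  · apply HP_le Fq hP
    intro i
    have := P.le_gaussNorm (avT Fq) zero_le_one i
    simpa [avT_apply] using this
  · obtain ⟨i, hi⟩ := P.exists_eq_gaussNorm (avT Fq) 1
    rw [hi]
    simpa [avT_apply] using absK_coeff_le_HP Fq P i

lemma HP_mul {P R : Polynomial (Polynomial Fq)} (hP : P ≠ 0) (hR : R ≠ 0) :
    HP Fq (P * R) = HP Fq P * HP Fq R := by
  rw [HP_eq_gauss Fq hP, HP_eq_gauss Fq hR, HP_eq_gauss Fq (mul_ne_zero hP hR)]
  exact gaussNorm_mul (avT_nonarch Fq) one_pos P R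

lemma finite_height (n : ℕ) (B : ℝ) :
    {P : Polynomial (Polynomial Fq) | P.natDegree ≤ n ∧ HP Fq P ≤ B}.Finite := by
  obtain ⟨N, hN⟩ := pow_unbounded_of_one_lt B (card_gt_one Fq)
  let f : Polynomial (Polynomial Fq) → (Fin (n+1) → Fin (N+1) → Fq) :=
    fun P i j => (P.coeff i).coeff j
  apply Set.Finite.of_finite_image (f := f) (Set.toFinite _)
  intro P hP R hR hPR
  have hdeg : ∀ S : Polynomial (Polynomial Fq), HP Fq S ≤ B → ∀ i, (S.coeff i).natDegree ≤ N := by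
    intro S hS i
    by_cases h : S.coeff i = 0
    · simp [h]
    have h1 := absK_coeff_le_HP Fq S i
    rw [absK_emb Fq h] at h1
    exact ((pow_lt_pow_iff_right₀ (card_gt_one Fq)).1 (lt_of_le_of_lt (h1.trans hS) hN)).le
  ext i j
  by_cases hi : i ≤ n
  · by_cases hj : j ≤ N
    · exact congrFun (congrFun hPR ⟨i, by omega⟩) ⟨j, by omega⟩
    · rw [coeff_eq_zero_of_natDegree_lt (lt_of_le_of_lt (hdeg P hP.2 i) (by omega)),
        coeff_eq_zero_of_natDegree_lt (lt_of_le_of_lt (hdeg R hR.2 i) (by omega))]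
  · rw [coeff_eq_zero_of_natDegree_lt (lt_of_le_of_lt hP.1 (by omega)),
      coeff_eq_zero_of_natDegree_lt (lt_of_le_of_lt hR.1 (by omega))]

lemma evalK_mul (P R : Polynomial (Polynomial Fq)) (x : K Fq) :
    evalK Fq (P * R) x = evalK Fq P x * evalK Fq R x := eval₂_mul _ _

lemma evalKbar_mul (P R : Polynomial (Polynomial Fq)) (x : Kbar Fq) :
    evalKbar Fq (P * R) x = evalKbar Fq P x * evalKbar Fq R x := eval₂_mul _ _

lemma evalKbar_algebraMap (P : Polynomial (Polynomial Fq)) (x : K Fq) :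
    evalKbar Fq P (algebraMap (K Fq) (Kbar Fq) x) = algebraMap (K Fq) (Kbar Fq) (evalK Fq P x) := by
  rw [evalKbar, evalK, embbar, hom_eval₂]

lemma evalKbar_eq_zero_iff (P : Polynomial (Polynomial Fq)) (x : K Fq) :
    evalKbar Fq P (algebraMap (K Fq) (Kbar Fq) x) = 0 ↔ evalK Fq P x = 0 := by
  rw [evalKbar_algebraMap, map_eq_zero]

lemma evalKbar_const_ne {c : Polynomial Fq} (hc : c ≠ 0) (x : Kbar Fq) :
    evalKbar Fq (C c) x ≠ 0 := by
  rw [evalKbar, eval₂_C]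
  intro h
  exact hc (embbar_injective Fq (by simpa using h))

lemma natDegree_pos_of_kill {P : Polynomial (Polynomial Fq)} (hP : P ≠ 0) {x : Kbar Fq}
    (h : evalKbar Fq P x = 0) : 0 < P.natDegree := by
  by_contra h0
  have h1 := eq_C_of_natDegree_eq_zero (by omega : P.natDegree = 0)
  rw [h1] at h
  refine evalKbar_const_ne Fq ?_ x h
  intro h2; rw [h2] at h1; exact hP (by simpa using h1)

lemma resultant_ne_zero_of_irreducible {P R : Polynomial (Polynomial Fq)} (hP : Irreducible P)
    (hd : 0 < P.natDegree) (hR : R ≠ 0) (hPR : ¬ P ∣ R) : resultant P R ≠ 0 := by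
  have hprim : P.IsPrimitive := hP.isPrimitive hd.ne'
  let L := FractionRing (Polynomial Fq)
  have hirr : Irreducible (P.map (algebraMap (Polynomial Fq) L)) :=
    (hprim.irreducible_iff_irreducible_map_fraction_map).1 hP
  have hinj : Function.Injective (algebraMap (Polynomial Fq) L) := IsFractionRing.injective _ _
  have hcop : IsCoprime (P.map (algebraMap (Polynomial Fq) L)) (R.map (algebraMap (Polynomial Fq) L)) := by
    rw [hirr.coprime_iff_not_dvd]
    intro hdvd
    apply hPR
    exact (IsPrimitive.dvd_iff_fraction_map_dvd_fraction_map L hprim).2 hdvd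
  intro h0
  have h2 := resultant_map_map (f := P) (g := R) (m := P.natDegree) (n := R.natDegree) (φ := algebraMap (Polynomial Fq) L)
  rw [h0, map_zero] at h2
  have h3 := (resultant_eq_zero_iff (f := P.map (algebraMap (Polynomial Fq) L))
    (g := R.map (algebraMap (Polynomial Fq) L))).1 (by
      rw [natDegree_map_eq_of_injective hinj, natDegree_map_eq_of_injective hinj]; exact h2)
  exact h3.2 hcop

/-! ### Minimal polynomials over `F_q[T]` -/

lemma dvd_of_kill {P R : Polynomial (Polynomial Fq)} (hP : Irreducible P) {x : Kbar Fq}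
    (hx : evalKbar Fq P x = 0) (hRx : evalKbar Fq R x = 0) : P ∣ R := by
  by_contra hPR
  have hR : R ≠ 0 := by rintro rfl; exact hPR (dvd_zero _)
  have hd := natDegree_pos_of_kill Fq hP.ne_zero hx
  have hres := resultant_ne_zero_of_irreducible Fq hP hd hR hPR
  obtain ⟨p, r, -, -, h⟩ := exists_mul_add_mul_eq_C_resultant P R le_rfl le_rfl (Or.inl hd.ne')
  have h2 : evalKbar Fq (P * p + R * r) x = 0 := by
    rw [evalKbar, eval₂_add, eval₂_mul, eval₂_mul]
    rw [evalKbar] at hx hRx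
    rw [hx, hRx]; simp
  rw [h] at h2
  exact evalKbar_const_ne Fq hres x h2

lemma exists_irreducible_kill {x : Kbar Fq} (h : IsAlgKbar Fq x) :
    ∃ P : Polynomial (Polynomial Fq), Irreducible P ∧ evalKbar Fq P x = 0 := by
  obtain ⟨R, hR, hRx⟩ := h
  induction R using WfDvdMonoid.induction_on_irreducible with
  | zero => exact absurd rfl hR
  | unit u hu =>
    obtain ⟨c, hc, hcu⟩ := Polynomial.isUnit_iff.1 hu
    rw [← hcu] at hRx
    exact absurd hRx (evalKbar_const_ne Fq hc.ne_zero x)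
  | mul a i ha hi ih =>
    rw [evalKbar_mul] at hRx
    rcases mul_eq_zero.1 hRx with h | h
    · exact ⟨i, hi, h⟩
    · exact ih ha h

lemma degAbar_eq {P : Polynomial (Polynomial Fq)} (hP : Irreducible P) {x : Kbar Fq}
    (hx : evalKbar Fq P x = 0) : degAbar Fq x = P.natDegree := by
  apply le_antisymm
  · exact Nat.sInf_le ⟨P, hP.ne_zero, rfl, hx⟩
  · refine le_csInf ⟨_, P, hP.ne_zero, rfl, hx⟩ ?_
    rintro d ⟨R, hR, rfl, hRx⟩
    exact natDegree_le_of_dvd (dvd_of_kill Fq hP hx hRx) hR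

lemma HP_le_of_dvd {P R : Polynomial (Polynomial Fq)} (hR : R ≠ 0) (h : P ∣ R) :
    HP Fq P ≤ HP Fq R := by
  obtain ⟨S, rfl⟩ := h
  have hP := left_ne_zero_of_mul hR
  have hS := right_ne_zero_of_mul hR
  rw [HP_mul Fq hP hS]
  exact le_mul_of_one_le_right (HP_pos Fq P).le (HP_ge_one Fq S)

lemma HAbar_eq {P : Polynomial (Polynomial Fq)} (hP : Irreducible P) {x : Kbar Fq}
    (hx : evalKbar Fq P x = 0) : HAbar Fq x = HP Fq P := by
  apply IsLeast.csInf_eq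
  refine ⟨⟨P, hP.ne_zero, (degAbar_eq Fq hP hx).symm, hx, rfl⟩, ?_⟩
  rintro h ⟨R, hR, -, hRx, rfl⟩
  exact HP_le_of_dvd Fq hR (dvd_of_kill Fq hP hx hRx)

lemma HAbar_le {R : Polynomial (Polynomial Fq)} (hR : R ≠ 0) {x : Kbar Fq}
    (hx : evalKbar Fq R x = 0) : HAbar Fq x ≤ HP Fq R := by
  obtain ⟨P, hP, hPx⟩ := exists_irreducible_kill Fq ⟨R, hR, hx⟩
  rw [HAbar_eq Fq hP hPx]
  exact HP_le_of_dvd Fq hR (dvd_of_kill Fq hP hPx hx)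

lemma HAbar_ge_one {x : Kbar Fq} (h : IsAlgKbar Fq x) : 1 ≤ HAbar Fq x := by
  obtain ⟨P, hP, hPx⟩ := exists_irreducible_kill Fq h
  rw [HAbar_eq Fq hP hPx]; exact HP_ge_one Fq P

lemma degAbar_le {R : Polynomial (Polynomial Fq)} (hR : R ≠ 0) {x : Kbar Fq}
    (hx : evalKbar Fq R x = 0) : degAbar Fq x ≤ R.natDegree :=
  Nat.sInf_le ⟨R, hR, rfl, hx⟩

lemma IsAlgKbar_algebraMap (x : K Fq) :
    IsAlgKbar Fq (algebraMap (K Fq) (Kbar Fq) x) ↔ IsAlgK Fq x := by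
  simp only [IsAlgKbar, IsAlgK, evalKbar_eq_zero_iff]

lemma degAbar_algebraMap (x : K Fq) :
    degAbar Fq (algebraMap (K Fq) (Kbar Fq) x) = degA Fq x := by
  simp only [degAbar, degA, evalKbar_eq_zero_iff]

lemma HAbar_algebraMap (x : K Fq) :
    HAbar Fq (algebraMap (K Fq) (Kbar Fq) x) = HA Fq x := by
  simp only [HAbar, HA, evalKbar_eq_zero_iff, degAbar_algebraMap]

lemma absC_algebraMap_sub (x y : K Fq) :
    avC Fq (algebraMap (K Fq) (Kbar Fq) x - algebraMap (K Fq) (Kbar Fq) y) = absK Fq (x - y) := by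
  rw [← map_sub, avC_algebraMap]

/-! ### Roots -/

/-- The multiset of roots in `Kbar`. -/
def rt (P : Polynomial (Polynomial Fq)) : Multiset (Kbar Fq) := (P.map (embbar Fq)).roots

lemma map_embbar_ne {P : Polynomial (Polynomial Fq)} (hP : P ≠ 0) : P.map (embbar Fq) ≠ 0 :=
  (Polynomial.map_ne_zero_iff (embbar_injective Fq)).2 hP

lemma mem_rt {P : Polynomial (Polynomial Fq)} (hP : P ≠ 0) {x : Kbar Fq} :
    x ∈ rt Fq P ↔ evalKbar Fq P x = 0 := by
  rw [rt, mem_roots (map_embbar_ne Fq hP), IsRoot.def, eval_map, evalKbar]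

lemma card_rt (P : Polynomial (Polynomial Fq)) : Multiset.card (rt Fq P) = P.natDegree := by
  have h := (IsAlgClosed.splits (P.map (embbar Fq))).natDegree_eq_card_roots
  rw [natDegree_map_eq_of_injective (embbar_injective Fq)] at h
  exact h.symm

lemma map_eq_prod (P : Polynomial (Polynomial Fq)) : P.map (embbar Fq) =
    C (embbar Fq P.leadingCoeff) * ((rt Fq P).map fun a => X - C a).prod := by
  have h := (IsAlgClosed.splits (P.map (embbar Fq))).eq_prod_roots
  rw [leadingCoeff_map_of_injective (embbar_injective Fq)] at h
  exact h

lemma eval_eq_prod (P : Polynomial (Polynomial Fq)) (x : Kbar Fq) : evalKbar Fq P x =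
    embbar Fq P.leadingCoeff * ((rt Fq P).map fun a => x - a).prod := by
  rw [evalKbar, ← eval_map, map_eq_prod, eval_mul, eval_C, eval_multiset_prod, Multiset.map_map]
  simp

lemma avC_conj (ξ : K Fq) {x y : Kbar Fq} (h : minpoly (K Fq) x = minpoly (K Fq) y) :
    avC Fq (algebraMap (K Fq) (Kbar Fq) ξ - x) = avC Fq (algebraMap (K Fq) (Kbar Fq) ξ - y) := by
  rw [(avC Fq).map_sub, (avC Fq).map_sub _ y, avC_apply, avC_apply, absC, absC,
    minpoly.sub_algebraMap, minpoly.sub_algebraMap, h]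

lemma Kmem {P : Polynomial (Polynomial Fq)} (hP : P ≠ 0) (ξ : K Fq) {x : Kbar Fq}
    (hx : x ∈ rt Fq P) (hxK : x ∉ Set.range (algebraMap (K Fq) (Kbar Fq))) :
    ∃ y ∈ (rt Fq P).erase x,
      avC Fq (algebraMap (K Fq) (Kbar Fq) ξ - y) = avC Fq (algebraMap (K Fq) (Kbar Fq) ξ - x) := by
  have hxint : IsIntegral (K Fq) x := Algebra.IsIntegral.isIntegral x
  have hm0 := minpoly.ne_zero hxint
  have hdvd : minpoly (K Fq) x ∣ P.map (emb Fq) := by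
    apply minpoly.dvd
    rw [mem_rt Fq hP] at hx
    rw [aeval_def, eval₂_map]; exact hx
  have hmap : (P.map (emb Fq)).map (algebraMap (K Fq) (Kbar Fq)) = P.map (embbar Fq) := by
    rw [Polynomial.map_map]; rfl
  have hle : ((minpoly (K Fq) x).map (algebraMap (K Fq) (Kbar Fq))).roots ≤ rt Fq P := by
    apply roots.le_of_dvd (map_embbar_ne Fq hP)
    rw [← hmap]; exact Polynomial.map_dvd _ hdvd
  have hcard : 2 ≤ Multiset.card ((minpoly (K Fq) x).map (algebraMap (K Fq) (Kbar Fq))).roots := by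
    rw [← (IsAlgClosed.splits _).natDegree_eq_card_roots, natDegree_map]
    rw [minpoly.two_le_natDegree_iff hxint]
    exact hxK
  have hxm : x ∈ ((minpoly (K Fq) x).map (algebraMap (K Fq) (Kbar Fq))).roots := by
    rw [mem_roots (Polynomial.map_ne_zero hm0), IsRoot.def, eval_map_algebraMap, minpoly.aeval]
  have hpos : 0 < Multiset.card
      (((minpoly (K Fq) x).map (algebraMap (K Fq) (Kbar Fq))).roots.erase x) := by
    rw [Multiset.card_erase_of_mem hxm, Nat.pred_eq_sub_one]; omega
  obtain ⟨y, hy⟩ := Multiset.card_pos_iff_exists_mem.1 hpos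
  refine ⟨y, Multiset.mem_of_le (Multiset.erase_le_erase x hle) hy, ?_⟩
  apply avC_conj
  have hy2 := Multiset.mem_of_mem_erase hy
  rw [mem_roots (Polynomial.map_ne_zero hm0), IsRoot.def, eval_map_algebraMap] at hy2
  exact (minpoly.eq_of_irreducible_of_monic (minpoly.irreducible hxint) hy2
    (minpoly.monic hxint)).symm

/-- Newton-type lemma: some root is within `|P(ξ)| / |P'(ξ)|` of `ξ`. -/
lemma newton {P : Polynomial (Polynomial Fq)} (hP : P ≠ 0) (x : Kbar Fq)
    (hx : evalKbar Fq P x ≠ 0) (hx' : evalKbar Fq (derivative P) x ≠ 0) :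
    ∃ y ∈ rt Fq P, avC Fq (x - y) * avC Fq (evalKbar Fq (derivative P) x) ≤
      avC Fq (evalKbar Fq P x) := by
  have hsum := Splits.eval_derivative_div_eval_of_ne_zero (f := P.map (embbar Fq)) (x := x)
    (IsAlgClosed.splits _) (by rw [eval_map]; exact hx)
  rw [derivative_map, eval_map, eval_map] at hsum
  change evalKbar Fq (derivative P) x / evalKbar Fq P x = _ at hsum
  have hne : (rt Fq P) ≠ 0 := by
    intro h
    change (P.map (embbar Fq)).roots = 0 at h
    rw [h] at hsum
    simp [hx, hx'] at hsum
  have hex : ∃ y ∈ rt Fq P, avC Fq (evalKbar Fq (derivative P) x / evalKbar Fq P x) ≤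
      avC Fq (1 / (x - y)) := by
    rw [hsum]
    change ∃ y ∈ rt Fq P, avC Fq ((rt Fq P).map _).sum ≤ _
    generalize rt Fq P = s at hne
    clear hsum
    induction s using Multiset.induction_on with
    | empty => exact absurd rfl hne
    | cons a s ih =>
      rw [Multiset.map_cons, Multiset.sum_cons]
      by_cases hs : s = 0
      · subst hs
        exact ⟨a, by simp, by simp⟩
      · obtain ⟨y, hy, hy2⟩ := ih hs
        rcases le_max_iff.1 (avC_nonarch Fq (1 / (x - a)) (s.map fun y => 1 / (x - y)).sum) with h | h
        · exact ⟨a, by simp, h⟩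
        · exact ⟨y, by simp [hy], h.trans hy2⟩
  obtain ⟨y, hy, h⟩ := hex
  refine ⟨y, hy, ?_⟩
  have hxy : x - y ≠ 0 := by
    intro h0
    rw [sub_eq_zero] at h0
    rw [← h0, mem_rt Fq hP] at hy
    exact hx hy
  rw [map_div₀, map_div₀, map_one, div_le_div_iff₀ ((avC Fq).pos hx) ((avC Fq).pos hxy), one_mul] at h
  linarith

/-! ### Mahler-type measure and the resultant inequality -/

/-- Distance to `ξ`. -/
def dd (ξ : K Fq) (a : Kbar Fq) : ℝ := avC Fq (algebraMap (K Fq) (Kbar Fq) ξ - a)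

lemma dd_nonneg (ξ : K Fq) (a : Kbar Fq) : 0 ≤ dd Fq ξ a := (avC Fq).nonneg _

/-- Truncated distance to `ξ`. -/
def ff (ξ : K Fq) (a : Kbar Fq) : ℝ := min 1 (dd Fq ξ a)

/-- Mahler measure around `ξ`. -/
def MM (ξ : K Fq) (P : Polynomial (Polynomial Fq)) : ℝ :=
  avC Fq (embbar Fq P.leadingCoeff) * ((rt Fq P).map fun a => max 1 (dd Fq ξ a)).prod

/-- The product of truncated distances. -/
def pp (ξ : K Fq) (P : Polynomial (Polynomial Fq)) : ℝ := ((rt Fq P).map (ff Fq ξ)).prod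

/-- Comparison constant. -/
def cc (ξ : K Fq) : ℝ := max 1 (absK Fq ξ)

lemma cc_ge_one (ξ : K Fq) : 1 ≤ cc Fq ξ := le_max_left _ _

lemma avC_embbar (a : Polynomial Fq) : avC Fq (embbar Fq a) = absK Fq (emb Fq a) :=
  avC_algebraMap Fq _

lemma avC_multiset_prod (s : Multiset (Kbar Fq)) : avC Fq s.prod = (s.map (avC Fq)).prod := by
  induction s using Multiset.induction_on with
  | empty => simp
  | cons a s ih => simp [ih]

lemma absK_eval_eq (ξ : K Fq) (P : Polynomial (Polynomial Fq)) :
    absK Fq (evalK Fq P ξ) = MM Fq ξ P * pp Fq ξ P := by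
  rw [← avC_algebraMap, ← evalKbar_algebraMap, eval_eq_prod, map_mul, avC_multiset_prod,
    Multiset.map_map, MM, pp, mul_assoc, ← Multiset.prod_map_mul]
  congr 2
  apply Multiset.map_congr rfl
  intro a _
  simp only [Function.comp, ff, dd]
  rw [max_mul_min]; simp

lemma avC_sub_le (x y : Kbar Fq) : avC Fq (x - y) ≤ max (avC Fq x) (avC Fq y) := by
  have := avC_nonarch Fq x (-y)
  rwa [← sub_eq_add_neg, (avC Fq).map_neg] at this

lemma gaussNorm_X_sub_C (a : Kbar Fq) : (X - C a : Polynomial (Kbar Fq)).gaussNorm (avC Fq) 1 =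
    max 1 (avC Fq a) := by
  apply le_antisymm
  · obtain ⟨i, hi⟩ := (X - C a : Polynomial (Kbar Fq)).exists_eq_gaussNorm (avC Fq) 1
    rw [hi]
    rcases i with _ | _ | i
    · simp
    · simp [coeff_X, coeff_C]
    · simp [coeff_X, coeff_C]
  · apply max_le
    · have h := (X - C a : Polynomial (Kbar Fq)).le_gaussNorm (avC Fq) zero_le_one 1
      rw [coeff_sub, coeff_X_one, coeff_C_of_ne_zero one_ne_zero] at h
      simpa using h
    · have h := (X - C a : Polynomial (Kbar Fq)).le_gaussNorm (avC Fq) zero_le_one 0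
      rw [coeff_sub, coeff_X_zero, coeff_C_zero] at h
      simpa using h

lemma gaussNorm_multiset (s : Multiset (Kbar Fq)) :
    (s.map fun a => (X - C a : Polynomial (Kbar Fq))).prod.gaussNorm (avC Fq) 1 =
      (s.map fun a => max 1 (avC Fq a)).prod := by
  induction s using Multiset.induction_on with
  | empty =>
    have := gaussNorm_C (avC Fq) 1 (1 : Kbar Fq)
    simpa using this
  | cons a s ih =>
    rw [Multiset.map_cons, Multiset.prod_cons, gaussNorm_mul (avC_nonarch Fq) one_pos, ih,
      gaussNorm_X_sub_C, Multiset.map_cons, Multiset.prod_cons]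

lemma HP_eq_prod {P : Polynomial (Polynomial Fq)} (hP : P ≠ 0) :
    HP Fq P = avC Fq (embbar Fq P.leadingCoeff) *
      ((rt Fq P).map fun a => max 1 (avC Fq a)).prod := by
  have h : HP Fq P = (P.map (embbar Fq)).gaussNorm (avC Fq) 1 := by
    apply le_antisymm
    · apply HP_le Fq hP
      intro i
      have := (P.map (embbar Fq)).le_gaussNorm (avC Fq) zero_le_one i
      simpa [avC_embbar] using this
    · obtain ⟨i, hi⟩ := (P.map (embbar Fq)).exists_eq_gaussNorm (avC Fq) 1
      rw [hi]
      simpa [avC_embbar] using absK_coeff_le_HP Fq P i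
  rw [h, map_eq_prod, gaussNorm_mul (avC_nonarch Fq) one_pos, gaussNorm_C, gaussNorm_multiset]

lemma prod_compare {ι : Type*} (s : Multiset ι) (f g : ι → ℝ) (c : ℝ)
    (hf : ∀ a, 0 ≤ f a) (hfg : ∀ a, f a ≤ c * g a) :
    (s.map f).prod ≤ c ^ (Multiset.card s) * (s.map g).prod := by
  have h1 : (s.map f).prod ≤ (s.map fun a => c * g a).prod :=
    Multiset.prod_map_le_prod_map₀ _ _ (fun a _ => hf a) (fun a _ => hfg a)
  rw [Multiset.prod_map_mul, Multiset.map_const', Multiset.prod_replicate] at h1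
  exact h1

lemma MM_le (ξ : K Fq) {P : Polynomial (Polynomial Fq)} (hP : P ≠ 0) {n : ℕ}
    (hn : P.natDegree ≤ n) : MM Fq ξ P ≤ cc Fq ξ ^ n * HP Fq P := by
  have h := prod_compare (rt Fq P) (fun a => max 1 (dd Fq ξ a)) (fun a => max 1 (avC Fq a))
    (cc Fq ξ) (fun a => by positivity) (fun a => by
      have h1 := cc_ge_one Fq ξ
      have h2 : absK Fq ξ ≤ cc Fq ξ := le_max_right _ _
      have h3 : 1 ≤ max 1 (avC Fq a) := le_max_left _ _
      have h4 : avC Fq a ≤ max 1 (avC Fq a) := le_max_right _ _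
      apply max_le
      · nlinarith
      · refine (avC_sub_le Fq _ _).trans (max_le ?_ ?_)
        · rw [avC_algebraMap]; nlinarith
        · nlinarith)
  rw [card_rt] at h
  have h2 : cc Fq ξ ^ P.natDegree ≤ cc Fq ξ ^ n := pow_le_pow_right₀ (cc_ge_one Fq ξ) hn
  rw [MM, HP_eq_prod Fq hP]
  have h3 : 0 ≤ ((rt Fq P).map fun a => max 1 (avC Fq a)).prod :=
    Multiset.prod_nonneg (by simp only [Multiset.mem_map]; rintro _ ⟨a, _, rfl⟩; positivity)
  have h4 := (avC Fq).nonneg (embbar Fq P.leadingCoeff)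
  calc _ ≤ avC Fq (embbar Fq P.leadingCoeff) * (cc Fq ξ ^ n *
        ((rt Fq P).map fun a => max 1 (avC Fq a)).prod) := by
        apply mul_le_mul_of_nonneg_left _ h4
        exact h.trans (mul_le_mul_of_nonneg_right h2 h3)
    _ = _ := by ring

lemma HP_le_MM (ξ : K Fq) {P : Polynomial (Polynomial Fq)} (hP : P ≠ 0) {n : ℕ}
    (hn : P.natDegree ≤ n) : HP Fq P ≤ cc Fq ξ ^ n * MM Fq ξ P := by
  have h := prod_compare (rt Fq P) (fun a => max 1 (avC Fq a)) (fun a => max 1 (dd Fq ξ a))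
    (cc Fq ξ) (fun a => by positivity) (fun a => by
      have h1 := cc_ge_one Fq ξ
      have h2 : absK Fq ξ ≤ cc Fq ξ := le_max_right _ _
      have h3 : 1 ≤ max 1 (dd Fq ξ a) := le_max_left _ _
      have h4 : dd Fq ξ a ≤ max 1 (dd Fq ξ a) := le_max_right _ _
      apply max_le
      · nlinarith
      · have h5 : a = algebraMap (K Fq) (Kbar Fq) ξ - (algebraMap (K Fq) (Kbar Fq) ξ - a) := by ring
        have h6 := avC_sub_le Fq (algebraMap (K Fq) (Kbar Fq) ξ) (algebraMap (K Fq) (Kbar Fq) ξ - a)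
        rw [← h5] at h6
        refine h6.trans (max_le ?_ ?_)
        · rw [avC_algebraMap]; nlinarith
        · change dd Fq ξ a ≤ _
          nlinarith)
  rw [card_rt] at h
  have h2 : cc Fq ξ ^ P.natDegree ≤ cc Fq ξ ^ n := pow_le_pow_right₀ (cc_ge_one Fq ξ) hn
  rw [MM, HP_eq_prod Fq hP]
  have h3 : 0 ≤ ((rt Fq P).map fun a => max 1 (dd Fq ξ a)).prod :=
    Multiset.prod_nonneg (by simp only [Multiset.mem_map]; rintro _ ⟨a, _, rfl⟩; positivity)
  have h4 := (avC Fq).nonneg (embbar Fq P.leadingCoeff)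
  calc _ ≤ avC Fq (embbar Fq P.leadingCoeff) * (cc Fq ξ ^ n *
        ((rt Fq P).map fun a => max 1 (dd Fq ξ a)).prod) := by
        apply mul_le_mul_of_nonneg_left _ h4
        exact h.trans (mul_le_mul_of_nonneg_right h2 h3)
    _ = _ := by ring

lemma MM_nonneg (ξ : K Fq) (P : Polynomial (Polynomial Fq)) : 0 ≤ MM Fq ξ P := by
  apply mul_nonneg ((avC Fq).nonneg _)
  exact Multiset.prod_nonneg (by simp only [Multiset.mem_map]; rintro _ ⟨a, _, rfl⟩; positivity)

lemma ff_nonneg (ξ : K Fq) (a : Kbar Fq) : 0 ≤ ff Fq ξ a := le_min zero_le_one (dd_nonneg Fq ξ a)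

lemma pp_nonneg (ξ : K Fq) (P : Polynomial (Polynomial Fq)) : 0 ≤ pp Fq ξ P :=
  Multiset.prod_nonneg (by simp only [Multiset.mem_map]; rintro _ ⟨a, _, rfl⟩; exact ff_nonneg Fq ξ a)

/-- The double product in the resultant bound. -/
def RR (s t : Multiset ℝ) : ℝ := (s.map fun a => (t.map fun b => max a b).prod).prod

lemma resultant_bound (ξ : K Fq) {P R : Polynomial (Polynomial Fq)} (hP : Irreducible P)
    (hd : 0 < P.natDegree) (hR : R ≠ 0) (hPR : ¬ P ∣ R) :
    1 ≤ MM Fq ξ P ^ R.natDegree * MM Fq ξ R ^ P.natDegree *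
      RR ((rt Fq P).map (ff Fq ξ)) ((rt Fq R).map (ff Fq ξ)) := by
  have h1 := one_le_absK_emb Fq (resultant_ne_zero_of_irreducible Fq hP hd hR hPR)
  have h2 : embbar Fq (resultant P R) = embbar Fq P.leadingCoeff ^ R.natDegree *
      ((rt Fq P).map fun a => (embbar Fq R.leadingCoeff * ((rt Fq R).map fun b => a - b).prod)).prod := by
    rw [← resultant_map_map]
    have h3 := resultant_eq_prod_eval (P.map (embbar Fq)) (R.map (embbar Fq)) R.natDegree
      natDegree_map_le (IsAlgClosed.splits _)
    rw [natDegree_map_eq_of_injective (embbar_injective Fq),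
      leadingCoeff_map_of_injective (embbar_injective Fq)] at h3
    rw [h3]
    congr 2
    apply Multiset.map_congr rfl
    intro a _
    rw [eval_map]
    exact eval_eq_prod Fq R a
  rw [← avC_embbar, h2, map_mul, map_pow, avC_multiset_prod, Multiset.map_map] at h1
  refine h1.trans ?_
  have h4 : ((rt Fq P).map (avC Fq ∘ fun a => (embbar Fq R.leadingCoeff *
      ((rt Fq R).map fun b => a - b).prod))).prod ≤
      ((rt Fq P).map fun a => (avC Fq (embbar Fq R.leadingCoeff) *
      ((rt Fq R).map fun b => max 1 (dd Fq ξ a) * max 1 (dd Fq ξ b) *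
        max (ff Fq ξ a) (ff Fq ξ b)).prod)).prod := by
    apply Multiset.prod_map_le_prod_map₀
    · intro a _; exact (avC Fq).nonneg _
    intro a _
    simp only [Function.comp, map_mul, avC_multiset_prod, Multiset.map_map]
    apply mul_le_mul_of_nonneg_left _ ((avC Fq).nonneg _)
    apply Multiset.prod_map_le_prod_map₀
    · intro b _; exact (avC Fq).nonneg _
    intro b _
    have h5 : a - b = (algebraMap (K Fq) (Kbar Fq) ξ - b) - (algebraMap (K Fq) (Kbar Fq) ξ - a) := by
      ring
    rw [h5]
    refine (avC_sub_le Fq _ _).trans ?_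
    change max (dd Fq ξ b) (dd Fq ξ a) ≤ _
    have ha : max 1 (dd Fq ξ a) * ff Fq ξ a = dd Fq ξ a := by
      rw [ff, max_mul_min]; simp
    have hb : max 1 (dd Fq ξ b) * ff Fq ξ b = dd Fq ξ b := by
      rw [ff, max_mul_min]; simp
    have ha1 : 1 ≤ max 1 (dd Fq ξ a) := le_max_left _ _
    have hb1 : 1 ≤ max 1 (dd Fq ξ b) := le_max_left _ _
    have hfa : 0 ≤ ff Fq ξ a := le_min zero_le_one (dd_nonneg Fq ξ a)
    have hfb : 0 ≤ ff Fq ξ b := le_min zero_le_one (dd_nonneg Fq ξ b)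
    apply max_le
    · calc dd Fq ξ b = 1 * max 1 (dd Fq ξ b) * ff Fq ξ b := by rw [one_mul, hb]
        _ ≤ _ := by gcongr; exact le_max_right _ _
    · calc dd Fq ξ a = max 1 (dd Fq ξ a) * 1 * ff Fq ξ a := by rw [mul_one, ha]
        _ ≤ _ := by gcongr; exact le_max_left _ _
  refine (mul_le_mul_of_nonneg_left h4 (pow_nonneg ((avC Fq).nonneg _) _)).trans (le_of_eq ?_)
  rw [MM, MM, RR]
  simp only [Multiset.prod_map_mul, Multiset.map_const', Multiset.prod_replicate, card_rt,
    Multiset.map_map, Function.comp_def, mul_pow, Multiset.prod_map_pow]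
  ring

/-- Symmetric form of the resultant bound in terms of heights. -/
lemma resultant_bound' (ξ : K Fq) {P R : Polynomial (Polynomial Fq)} (hP : Irreducible P)
    (hd : 0 < P.natDegree) (hR : R ≠ 0) (hPR : ¬ P ∣ R) {n : ℕ} (hPn : P.natDegree ≤ n)
    (hRn : R.natDegree ≤ n) :
    1 ≤ (cc Fq ξ ^ n) ^ (2 * n) * HP Fq P ^ n * HP Fq R ^ n *
      RR ((rt Fq P).map (ff Fq ξ)) ((rt Fq R).map (ff Fq ξ)) := by
  refine (resultant_bound Fq ξ hP hd hR hPR).trans ?_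
  have hc := one_le_pow₀ (cc_ge_one Fq ξ) (n := n)
  have hRR : 0 ≤ RR ((rt Fq P).map (ff Fq ξ)) ((rt Fq R).map (ff Fq ξ)) := by
    apply Multiset.prod_nonneg
    simp only [Multiset.mem_map]
    rintro _ ⟨a, ⟨a', _, rfl⟩, rfl⟩
    apply Multiset.prod_nonneg
    simp only [Multiset.mem_map]
    rintro _ ⟨a, ⟨b, _, rfl⟩, rfl⟩
    exact le_max_of_le_left (ff_nonneg Fq ξ _)
  have key : ∀ S : Polynomial (Polynomial Fq), S ≠ 0 → S.natDegree ≤ n → ∀ m ≤ n,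
      MM Fq ξ S ^ m ≤ (cc Fq ξ ^ n) ^ n * HP Fq S ^ n := by
    intro S hS hSn m hm
    rw [← mul_pow]
    refine (pow_le_pow_left₀ (MM_nonneg Fq ξ S) (MM_le Fq ξ hS hSn) m).trans ?_
    apply pow_le_pow_right₀ _ hm
    have := HP_ge_one Fq S
    nlinarith
  calc _ ≤ ((cc Fq ξ ^ n) ^ n * HP Fq P ^ n) * ((cc Fq ξ ^ n) ^ n * HP Fq R ^ n) * _ := by
        apply mul_le_mul_of_nonneg_right _ hRR
        apply mul_le_mul (key P hP.ne_zero hPn _ hRn) (key R hR hRn _ hPn)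
          (pow_nonneg (MM_nonneg Fq ξ R) _)
        have := HP_pos Fq P
        positivity
    _ = _ := by ring

lemma pp_le (ξ : K Fq) {P : Polynomial (Polynomial Fq)} (hP : P ≠ 0) {n : ℕ}
    (hn : P.natDegree ≤ n) : pp Fq ξ P * HP Fq P ≤ cc Fq ξ ^ n * absK Fq (evalK Fq P ξ) := by
  rw [absK_eval_eq]
  have := mul_le_mul_of_nonneg_left (HP_le_MM Fq ξ hP hn) (pp_nonneg Fq ξ P)
  linarith

/-! ### Dirichlet-type lemma -/

lemma absK_sum_le {ι : Type*} (s : Finset ι) (f : ι → K Fq) {B : ℝ} (hB : 0 ≤ B)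
    (h : ∀ i ∈ s, absK Fq (f i) ≤ B) : absK Fq (∑ i ∈ s, f i) ≤ B := by
  induction s using Finset.induction_on with
  | empty => simpa [absK_zero] using hB
  | insert a s ha ih =>
    rw [Finset.sum_insert ha]
    refine (absK_add Fq _ _).trans (max_le (h a (by simp)) (ih fun i hi => h i (by simp [hi])))

lemma absK_pow (x : K Fq) (i : ℕ) : absK Fq (x ^ i) = absK Fq x ^ i := map_pow (avK Fq) x i

lemma absK_sub (x y : K Fq) : absK Fq (x - y) ≤ max (absK Fq x) (absK Fq y) := by
  have h := absK_add Fq x (-y)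
  have h2 : absK Fq (-y) = absK Fq y := (avK Fq).map_neg y
  rwa [h2, ← sub_eq_add_neg] at h

lemma absK_evalK_le (ξ : K Fq) {P : Polynomial (Polynomial Fq)} {m : ℕ} (hm : P.natDegree ≤ m)
    {B : ℝ} (hB : 0 ≤ B) (h : ∀ i, absK Fq (emb Fq (P.coeff i)) ≤ B) :
    absK Fq (evalK Fq P ξ) ≤ cc Fq ξ ^ m * B := by
  rw [evalK, eval₂_eq_sum_range]
  have hc := cc_ge_one Fq ξ
  apply absK_sum_le Fq _ _ (by positivity)
  intro i hi
  rw [absK_mul, absK_pow, mul_comm]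
  apply mul_le_mul _ (h i) (absK_nonneg Fq _) (by positivity)
  refine (pow_le_pow_left₀ (absK_nonneg Fq ξ) (le_max_right 1 _) i).trans ?_
  apply pow_le_pow_right₀ hc
  simp only [Finset.mem_range] at hi
  omega

lemma HP_bound (ξ : K Fq) {P : Polynomial (Polynomial Fq)} (hP : P ≠ 0) {n : ℕ} (hn1 : 1 ≤ n)
    (hn : P.natDegree ≤ n) {B : ℝ} (hB : 1 ≤ B) (h1 : absK Fq (evalK Fq P ξ) ≤ 1)
    (h : ∀ i, absK Fq (emb Fq (P.coeff (i + 1))) ≤ B) : HP Fq P ≤ cc Fq ξ ^ n * B := by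
  have hc := cc_ge_one Fq ξ
  have hcn : 1 ≤ cc Fq ξ ^ n := one_le_pow₀ hc
  apply HP_le Fq hP
  rintro (_ | i)
  · have hdec := P.divX_mul_X_add
    have he : emb Fq (P.coeff 0) = evalK Fq P ξ - evalK Fq P.divX ξ * ξ := by
      have h9 : evalK Fq P ξ = evalK Fq P.divX ξ * ξ + emb Fq (P.coeff 0) := by
        conv_lhs => rw [← hdec]
        simp only [evalK, eval₂_add, eval₂_mul, eval₂_X, eval₂_C]
      rw [h9]; ring
    rw [he]
    refine (absK_sub Fq _ _).trans (max_le ?_ ?_)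
    · nlinarith
    · rw [absK_mul]
      have h2 : absK Fq (evalK Fq P.divX ξ) ≤ cc Fq ξ ^ (n - 1) * B := by
        apply absK_evalK_le Fq ξ _ (by linarith)
        · intro i; rw [coeff_divX]; exact h i
        · rw [natDegree_divX_eq_natDegree_tsub_one]; omega
      have h3 : absK Fq ξ ≤ cc Fq ξ := le_max_right _ _
      have h4 : cc Fq ξ ^ n = cc Fq ξ ^ (n - 1) * cc Fq ξ := by
        rw [← pow_succ]; congr 1; omega
      rw [h4]
      calc _ ≤ (cc Fq ξ ^ (n - 1) * B) * cc Fq ξ :=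
            mul_le_mul h2 h3 (absK_nonneg Fq _) (by positivity)
        _ = _ := by ring
  · have := h i
    nlinarith

lemma dirichlet (ξ : K Fq) (n s : ℕ) (d : ℕ → ℕ) (hs : s < ∑ i ∈ Finset.range n, d i) :
    ∃ P : Polynomial (Polynomial Fq), P.natDegree ≤ n ∧ (∃ i, P.coeff (i + 1) ≠ 0) ∧
      (∀ i < n, (P.coeff (i + 1)).degree < d i) ∧
      absK Fq (evalK Fq P ξ) ≤ (Fintype.card Fq : ℝ) ^ (-((s : ℤ) + 1)) := by
  let V := (i : Fin n) → degreeLT Fq (d i)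
  let S : V → K Fq := fun v => ∑ i : Fin n, emb Fq (v i : Polynomial Fq) * ξ ^ ((i : ℕ) + 1)
  let g : V → (Fin s → Fq) := fun v j => (S v).coeff ((j : ℤ) + 1)
  haveI hfin : ∀ m, Module.Finite Fq (degreeLT Fq m) := fun m =>
    Module.Finite.equiv (degreeLTEquiv Fq m).symm
  haveI : Module.Finite Fq V := Module.Finite.pi
  have hfr : Module.finrank Fq V = ∑ i ∈ Finset.range n, d i := by
    rw [Module.finrank_pi_fintype, Finset.sum_range]
    apply Finset.sum_congr rfl
    intro i _
    rw [(degreeLTEquiv Fq (d i)).finrank_eq, Module.finrank_fin_fun]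
  haveI : Finite V := Module.finite_of_finite Fq
  have hcard : Nat.card (Fin s → Fq) < Nat.card V := by
    rw [Module.natCard_eq_pow_finrank (K := Fq) (V := V), hfr, Nat.card_fun, Nat.card_fin]
    exact Nat.pow_lt_pow_right (by rw [Nat.card_eq_fintype_card]; exact Fintype.one_lt_card) hs
  have hninj : ¬ Function.Injective g := fun hinj =>
    absurd (Nat.card_le_card_of_injective g hinj) (not_le.2 hcard)
  simp only [Function.Injective, not_forall] at hninj
  obtain ⟨x, y, hxy, hne⟩ := hninj
  let zz : ℕ → Polynomial Fq := fun i => if h : i < n then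
    ((x ⟨i, h⟩ : Polynomial Fq) - (y ⟨i, h⟩ : Polynomial Fq)) else 0
  let η : K Fq := S x - S y
  have hη : η = ∑ i ∈ Finset.range n, emb Fq (zz i) * ξ ^ (i + 1) := by
    rw [Finset.sum_range]
    simp only [η, S]
    rw [← Finset.sum_sub_distrib]
    apply Finset.sum_congr rfl
    intro i _
    simp only [zz, i.2, dif_pos, map_sub, sub_mul]
  have hηc : ∀ j : ℤ, 0 < j → j ≤ s → η.coeff j = 0 := by
    intro j h1 h2
    have := congrFun hxy ⟨(j - 1).toNat, by omega⟩
    simp only [g] at this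
    have h3 : (((j - 1).toNat : ℕ) : ℤ) + 1 = j := by omega
    rw [h3] at this
    simp only [η, HahnSeries.coeff_sub, this, sub_self]
  let a0 : Polynomial Fq := ∑ i ∈ Finset.range ((-η.order).toNat + 1), monomial i (η.coeff (-(i : ℤ)))
  have ha0 : ∀ i : ℕ, a0.coeff i = η.coeff (-(i : ℤ)) := by
    intro i
    simp only [a0, finset_sum_coeff, coeff_monomial, Finset.sum_ite_eq', Finset.mem_range]
    split_ifs with h
    · rfl
    · rw [HahnSeries.coeff_eq_zero_of_lt_order]; omega
  let Q : Polynomial (Polynomial Fq) := ∑ i ∈ Finset.range n, monomial i (zz i)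
  have hQ : ∀ i, Q.coeff i = zz i := by
    intro i
    simp only [Q, finset_sum_coeff, coeff_monomial, Finset.sum_ite_eq', Finset.mem_range]
    split_ifs with h
    · rfl
    · simp [zz, h]
  have hcoeff : ∀ i, (Q * X - C a0).coeff (i + 1) = zz i := by
    intro i
    rw [coeff_sub, coeff_mul_X, coeff_C_succ, sub_zero, hQ]
  refine ⟨Q * X - C a0, ?_, ?_, ?_, ?_⟩
  · rw [natDegree_le_iff_coeff_eq_zero]
    rintro (_ | N) hN
    · omega
    · rw [hcoeff]; simp only [zz]; rw [dif_neg (by omega)]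
  · by_contra! hall
    apply hne
    funext i
    have := hall i
    rw [hcoeff] at this
    simp only [zz, i.2, dif_pos, sub_eq_zero] at this
    exact Subtype.ext this
  · intro i hi
    rw [hcoeff]
    simp only [zz, hi, dif_pos]
    exact mem_degreeLT.1 (Submodule.sub_mem _ (x ⟨i, hi⟩).2 (y ⟨i, hi⟩).2)
  · have hev : evalK Fq (Q * X - C a0) ξ = η - emb Fq a0 := by
      rw [hη, evalK, eval₂_sub, eval₂_mul, eval₂_X, eval₂_C, eval₂_finset_sum, Finset.sum_mul]
      congr 1
      apply Finset.sum_congr rfl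
      intro i _
      rw [eval₂_monomial]; ring
    rw [hev, absK_le_iff]
    intro j hj
    rw [HahnSeries.coeff_sub, emb_coeff]
    by_cases h : j ≤ 0
    · rw [if_pos h, ha0, sub_eq_zero]; congr 1; omega
    · rw [if_neg h, sub_zero]; exact hηc j (by omega) (by omega)

/-! ### First consequences of the Dirichlet lemma -/

lemma infinite_of_small {ι : Type*} (S : Set ι) (φ : ι → ℝ) (hpos : ∀ x ∈ S, 0 < φ x)
    (h : ∀ ε > 0, ∃ x ∈ S, φ x < ε) : S.Infinite := by
  intro hfin
  obtain ⟨x0, hx0, -⟩ := h 1 one_pos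
  obtain ⟨a, ha, hmin⟩ := Set.exists_min_image S φ hfin ⟨x0, hx0⟩
  obtain ⟨x, hx, hlt⟩ := h (φ a) (hpos a ha)
  exact absurd (hmin x hx) (not_le.2 hlt)

lemma pos_min {ι : Type*} (S : Set ι) (hfin : S.Finite) (φ : ι → ℝ) (hpos : ∀ x ∈ S, 0 < φ x) :
    ∃ δ > 0, δ ≤ 1 ∧ ∀ x ∈ S, δ ≤ φ x := by
  by_cases hS : S.Nonempty
  · obtain ⟨a, ha, hmin⟩ := Set.exists_min_image S φ hfin hS
    exact ⟨min 1 (φ a), lt_min one_pos (hpos a ha), min_le_left _ _,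
      fun x hx => (min_le_right _ _).trans (hmin x hx)⟩
  · rw [Set.not_nonempty_iff_eq_empty] at hS
    exact ⟨1, one_pos, le_rfl, by simp [hS]⟩

lemma rpow_small (C θ ε : ℝ) (hθ : 0 < θ) (hε : 0 < ε) :
    ∀ᶠ x : ℝ in Filter.atTop, C * x ^ (-θ) < ε := by
  have h := (tendsto_rpow_neg_atTop hθ).const_mul C
  rw [mul_zero] at h
  exact h.eventually (gt_mem_nhds hε)

lemma tendsto_qpow : Filter.Tendsto (fun k : ℕ => (Fintype.card Fq : ℝ) ^ k) Filter.atTop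
    Filter.atTop := tendsto_pow_atTop_atTop_of_one_lt (card_gt_one Fq)

lemma absK_eval_pos {ξ : K Fq} {n : ℕ} (hna : ¬ IsAlgDegLe Fq ξ n)
    {P : Polynomial (Polynomial Fq)} (hP : P ≠ 0) (hn : P.natDegree ≤ n) :
    0 < absK Fq (evalK Fq P ξ) :=
  absK_pos Fq fun h => hna ⟨P, hP, hn, h⟩

lemma absK_emb_le_of_degree {a : Polynomial Fq} {k : ℕ} (h : a.degree < k) :
    absK Fq (emb Fq a) ≤ (Fintype.card Fq : ℝ) ^ k := by
  by_cases ha : a = 0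
  · rw [ha, map_zero, absK_zero]; exact (pow_pos (card_pos' Fq) _).le
  · rw [absK_emb Fq ha]
    apply pow_le_pow_right₀ (card_gt_one Fq).le
    exact ((natDegree_lt_iff_degree_lt ha).2 h).le

lemma dir_simple (ξ : K Fq) {n : ℕ} (hn : 1 ≤ n) {k : ℕ} (hk : 1 ≤ k) :
    ∃ P : Polynomial (Polynomial Fq), P ≠ 0 ∧ P.natDegree ≤ n ∧
      HP Fq P ≤ cc Fq ξ ^ n * (Fintype.card Fq : ℝ) ^ k ∧
      absK Fq (evalK Fq P ξ) ≤ ((Fintype.card Fq : ℝ) ^ k) ^ (-(n : ℝ)) := by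
  have hnk : 1 ≤ n * k := Nat.mul_pos hn hk
  obtain ⟨P, h1, ⟨i, hi⟩, h3, h4⟩ := dirichlet Fq ξ n (n * k - 1) (fun _ => k) (by
    simp only [Finset.sum_const, Finset.card_range, smul_eq_mul]; omega)
  have hP : P ≠ 0 := by rintro rfl; simp at hi
  have h5 : absK Fq (evalK Fq P ξ) ≤ ((Fintype.card Fq : ℝ) ^ k) ^ (-(n : ℝ)) := by
    refine h4.trans (le_of_eq ?_)
    have : -(((n * k - 1 : ℕ) : ℤ) + 1) = -((k * n : ℕ) : ℤ) := by
      rw [mul_comm k n]; omega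
    rw [this, Real.rpow_neg (by positivity), Real.rpow_natCast, zpow_neg, zpow_natCast, pow_mul]
  refine ⟨P, hP, h1, ?_, h5⟩
  have hq : 1 ≤ (Fintype.card Fq : ℝ) ^ k := one_le_pow₀ (card_gt_one Fq).le
  apply HP_bound Fq ξ hP hn h1 hq
  · refine h5.trans (Real.rpow_le_one_of_one_le_of_nonpos hq (by simp))
  · intro i
    by_cases hi : i < n
    · exact absK_emb_le_of_degree Fq (h3 i hi)
    · rw [coeff_eq_zero_of_natDegree_lt (by omega), map_zero, absK_zero]; positivity

lemma dir_small (ξ : K Fq) {n : ℕ} (hn : 1 ≤ n) {v : ℝ} (hv0 : 0 ≤ v) (hv : v < n) {ε : ℝ}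
    (hε : 0 < ε) : ∃ P : Polynomial (Polynomial Fq), P ≠ 0 ∧ P.natDegree ≤ n ∧
      absK Fq (evalK Fq P ξ) < ε ∧ absK Fq (evalK Fq P ξ) * HP Fq P ^ v < ε := by
  have hev := (tendsto_qpow Fq).eventually
    (rpow_small ((cc Fq ξ ^ n) ^ v) (n - v) ε (by linarith) hε)
  obtain ⟨k, hk, hk1⟩ := (hev.and (Filter.eventually_ge_atTop 1)).exists
  obtain ⟨P, hP, hPn, hH, hs⟩ := dir_simple Fq ξ hn hk1
  have hq : 0 < (Fintype.card Fq : ℝ) ^ k := pow_pos (card_pos' Fq) k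
  have hc := one_le_pow₀ (cc_ge_one Fq ξ) (n := n)
  have h1 : absK Fq (evalK Fq P ξ) * HP Fq P ^ v < ε := by
    refine lt_of_le_of_lt ?_ hk
    calc _ ≤ ((Fintype.card Fq : ℝ) ^ k) ^ (-(n : ℝ)) *
          (cc Fq ξ ^ n * (Fintype.card Fq : ℝ) ^ k) ^ v := by
          apply mul_le_mul hs _ (Real.rpow_nonneg (HP_pos Fq P).le _) (by positivity)
          exact Real.rpow_le_rpow (HP_pos Fq P).le hH hv0
      _ = _ := by
          rw [Real.mul_rpow (by linarith) hq.le, show -((n : ℝ) - v) = -n + v by ring,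
            Real.rpow_add hq]
          ring
  refine ⟨P, hP, hPn, lt_of_le_of_lt ?_ h1, h1⟩
  exact le_mul_of_one_le_right (absK_nonneg Fq _) (Real.one_le_rpow (HP_ge_one Fq P) hv0)

lemma mem_wnSet {ξ : K Fq} {n : ℕ} (hn : 1 ≤ n) (hna : ¬ IsAlgDegLe Fq ξ n) {v : ℝ}
    (hv0 : 0 ≤ v) (hv : v < n) : v ∈ wnSet Fq ξ n := by
  apply infinite_of_small _ (fun P => absK Fq (evalK Fq P ξ))
  · intro P hP; exact hP.2.1
  intro ε hε
  obtain ⟨P, hP, hPn, h1, h2⟩ := dir_small Fq ξ hn hv0 hv (ε := min 1 ε) (lt_min one_pos hε)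
  refine ⟨P, ⟨hPn, absK_eval_pos Fq hna hP hPn, ?_⟩, lt_of_lt_of_le h1 (min_le_right _ _)⟩
  rw [Real.rpow_neg (HP_pos Fq P).le, ← one_div, lt_div_iff₀ (Real.rpow_pos_of_pos (HP_pos Fq P) _)]
  exact lt_of_lt_of_le h2 (min_le_left _ _)

lemma one_le_absK_of_const {ξ : K Fq} {P : Polynomial (Polynomial Fq)} (hP : P ≠ 0)
    (hd : P.natDegree = 0) : 1 ≤ absK Fq (evalK Fq P ξ) := by
  rw [eq_C_of_natDegree_eq_zero hd, evalK, eval₂_C]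
  apply one_le_absK_emb
  intro h
  apply hP
  rw [eq_C_of_natDegree_eq_zero hd, h, C_0]

lemma exists_irreducible_small {ξ : K Fq} {n : ℕ} (hn : 1 ≤ n) (hna : ¬ IsAlgDegLe Fq ξ n) {v : ℝ}
    (hv0 : 0 ≤ v) (hv : v < n) (B : ℝ) : ∃ P : Polynomial (Polynomial Fq), Irreducible P ∧
      P.natDegree ≤ n ∧ 0 < P.natDegree ∧ B < HP Fq P ∧
      absK Fq (evalK Fq P ξ) < HP Fq P ^ (-v) := by
  by_contra! hcon
  obtain ⟨δ, hδ0, hδ1, hδ⟩ := pos_min {P : Polynomial (Polynomial Fq) |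
    P ≠ 0 ∧ P.natDegree ≤ n ∧ HP Fq P ≤ B}
    ((finite_height Fq n B).subset fun P hP => hP.2) (fun P => absK Fq (evalK Fq P ξ))
    (fun P hP => absK_eval_pos Fq hna hP.1 hP.2.1)
  have hpow : ∀ P : Polynomial (Polynomial Fq), 1 ≤ HP Fq P ^ v := fun P =>
    Real.one_le_rpow (HP_ge_one Fq P) hv0
  have hirr : ∀ P : Polynomial (Polynomial Fq), Irreducible P → P.natDegree ≤ n →
      δ ^ P.natDegree ≤ absK Fq (evalK Fq P ξ) * HP Fq P ^ v := by
    intro P hP hPn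
    by_cases hd : P.natDegree = 0
    · rw [hd, pow_zero]
      exact one_le_mul_of_one_le_of_one_le (one_le_absK_of_const Fq hP.ne_zero hd) (hpow P)
    by_cases hB : HP Fq P ≤ B
    · refine (pow_le_of_le_one hδ0.le hδ1 hd).trans ((hδ P ⟨hP.ne_zero, hPn, hB⟩).trans ?_)
      exact le_mul_of_one_le_right (absK_nonneg Fq _) (hpow P)
    · refine (pow_le_one₀ hδ0.le hδ1).trans ?_
      have h := hcon P hP hPn (Nat.pos_of_ne_zero hd) (not_le.1 hB)
      rw [Real.rpow_neg (HP_pos Fq P).le, ← one_div,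
        div_le_iff₀ (Real.rpow_pos_of_pos (HP_pos Fq P) _)] at h
      exact h
  have hall : ∀ P : Polynomial (Polynomial Fq), P ≠ 0 → P.natDegree ≤ n →
      δ ^ P.natDegree ≤ absK Fq (evalK Fq P ξ) * HP Fq P ^ v := by
    intro P
    induction P using WfDvdMonoid.induction_on_irreducible with
    | zero => intro h; exact absurd rfl h
    | unit u hu =>
      intro hu0 _
      have hd := natDegree_eq_zero_of_isUnit hu
      rw [hd, pow_zero]
      exact one_le_mul_of_one_le_of_one_le (one_le_absK_of_const Fq hu0 hd) (hpow u)
    | mul a i ha hi ih =>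
      intro h0 hdeg
      rw [natDegree_mul hi.ne_zero ha] at hdeg ⊢
      rw [evalK_mul, absK_mul, HP_mul Fq hi.ne_zero ha, pow_add,
        Real.mul_rpow (HP_pos Fq i).le (HP_pos Fq a).le]
      have h1 := hirr i hi (by omega)
      have h2 := ih ha (by omega)
      calc _ ≤ (absK Fq (evalK Fq i ξ) * HP Fq i ^ v) * (absK Fq (evalK Fq a ξ) * HP Fq a ^ v) :=
            mul_le_mul h1 h2 (by positivity) ((pow_pos hδ0 _).le.trans h1)
        _ = _ := by ring
  obtain ⟨P, hP, hPn, -, h2⟩ := dir_small Fq ξ hn hv0 hv (pow_pos hδ0 n)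
  have h3 := hall P hP hPn
  have h4 : δ ^ n ≤ δ ^ P.natDegree := pow_le_pow_of_le_one hδ0.le hδ1 hPn
  linarith

lemma absK_natCast_le (m : ℕ) : absK Fq (m : K Fq) ≤ 1 :=
  (avK_nonarch Fq).apply_natCast_le_one_of_isNonarchimedean (n := m)

lemma newtonD {ξ : K Fq} {n : ℕ} (hn : 1 ≤ n) (hna : ¬ IsAlgDegLe Fq ξ n)
    {P : Polynomial (Polynomial Fq)} (hPn : P.natDegree ≤ n) {B : ℝ} (hB : 0 ≤ B)
    (h1 : absK Fq (evalK Fq P ξ) ≤ 1)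
    (hBa : ∀ i, absK Fq (emb Fq (P.coeff (i + 2))) ≤ B)
    (ha : cc Fq ξ ^ n * B < absK Fq (emb Fq (P.coeff 1))) :
    ∃ α : Kbar Fq, IsAlgKbar Fq α ∧ degAbar Fq α ≤ n ∧
      HAbar Fq α ≤ cc Fq ξ ^ n * absK Fq (emb Fq (P.coeff 1)) ∧
      0 < absC Fq (algebraMap (K Fq) (Kbar Fq) ξ - α) ∧
      absC Fq (algebraMap (K Fq) (Kbar Fq) ξ - α) * HAbar Fq α ≤
        cc Fq ξ ^ n * absK Fq (evalK Fq P ξ) := by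
  have hc := cc_ge_one Fq ξ
  have hcn := one_le_pow₀ hc (n := n)
  have ha1 : P.coeff 1 ≠ 0 := by
    intro h
    rw [h, map_zero, absK_zero] at ha
    have : 0 ≤ cc Fq ξ ^ n * B := by positivity
    linarith
  have hP : P ≠ 0 := by rintro rfl; simp at ha1
  have hone := one_le_absK_emb Fq ha1
  have hBle : B ≤ absK Fq (emb Fq (P.coeff 1)) := by nlinarith
  have hH : HP Fq P ≤ cc Fq ξ ^ n * absK Fq (emb Fq (P.coeff 1)) := by
    apply HP_bound Fq ξ hP hn hPn hone h1
    rintro (_ | i)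
    · exact le_rfl
    · exact (hBa i).trans hBle
  -- the derivative
  have hder : absK Fq (emb Fq (P.coeff 1)) ≤ absK Fq (evalK Fq (derivative P) ξ) := by
    have hdec := (derivative P).divX_mul_X_add
    have he : emb Fq (P.coeff 1) =
        evalK Fq (derivative P) ξ - evalK Fq (derivative P).divX ξ * ξ := by
      have h9 : evalK Fq (derivative P) ξ = evalK Fq (derivative P).divX ξ * ξ +
          emb Fq ((derivative P).coeff 0) := by
        conv_lhs => rw [← hdec]
        simp only [evalK, eval₂_add, eval₂_mul, eval₂_X, eval₂_C]
      rw [h9, coeff_derivative]; simp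
    have h2 : absK Fq (evalK Fq (derivative P).divX ξ) ≤ cc Fq ξ ^ (n - 1) * B := by
      apply absK_evalK_le Fq ξ _ hB
      · intro i
        rw [coeff_divX, coeff_derivative, map_mul, absK_mul]
        have h3 : absK Fq (emb Fq (((i + 1 : ℕ) : Polynomial Fq) + 1)) ≤ 1 := by
          have h4 := absK_natCast_le Fq (i + 2)
          have h5 : emb Fq (((i + 1 : ℕ) : Polynomial Fq) + 1) = ((i + 2 : ℕ) : K Fq) := by
            rw [map_add, map_natCast, map_one]; push_cast; ring
          rw [h5]; exact h4
        exact (mul_le_of_le_one_right (absK_nonneg Fq _) h3).trans (hBa i)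
      · rw [natDegree_divX_eq_natDegree_tsub_one]
        have := natDegree_derivative_le P
        omega
    have h3 : absK Fq ξ ≤ cc Fq ξ := le_max_right _ _
    have h4 : cc Fq ξ ^ n = cc Fq ξ ^ (n - 1) * cc Fq ξ := by
      rw [← pow_succ]; congr 1; omega
    have h5 : absK Fq (evalK Fq (derivative P).divX ξ * ξ) ≤ cc Fq ξ ^ n * B := by
      rw [absK_mul, h4]
      calc _ ≤ (cc Fq ξ ^ (n - 1) * B) * cc Fq ξ :=
            mul_le_mul h2 h3 (absK_nonneg Fq _) (by positivity)
        _ = _ := by ring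
    have h6 := absK_sub Fq (evalK Fq (derivative P) ξ) (evalK Fq (derivative P).divX ξ * ξ)
    rw [← he] at h6
    rcases le_max_iff.1 h6 with h | h
    · exact h
    · linarith
  have hpos := absK_eval_pos Fq hna hP hPn
  obtain ⟨y, hy, hyle⟩ := newton Fq hP (algebraMap (K Fq) (Kbar Fq) ξ)
    (by
      rw [Ne, evalKbar_eq_zero_iff]
      intro h; rw [h, absK_zero] at hpos; exact lt_irrefl _ hpos)
    (by
      rw [Ne, evalKbar_eq_zero_iff]
      intro h; rw [h, absK_zero] at hder; linarith)
  rw [evalKbar_algebraMap, evalKbar_algebraMap, avC_algebraMap, avC_algebraMap] at hyle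
  have hyk := (mem_rt Fq hP).1 hy
  have hHy := HAbar_le Fq hP hyk
  refine ⟨y, ⟨P, hP, hyk⟩, (degAbar_le Fq hP hyk).trans hPn, hHy.trans hH, ?_, ?_⟩
  · rw [← avC_apply]
    apply (avC Fq).pos
    intro h
    rw [sub_eq_zero] at h
    rw [← h, evalKbar_eq_zero_iff] at hyk
    exact hna ⟨P, hP, hPn, hyk⟩
  · rw [← avC_apply]
    have hnn := (avC Fq).nonneg (algebraMap (K Fq) (Kbar Fq) ξ - y)
    calc _ ≤ avC Fq (algebraMap (K Fq) (Kbar Fq) ξ - y) *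
          (cc Fq ξ ^ n * absK Fq (emb Fq (P.coeff 1))) :=
          mul_le_mul_of_nonneg_left (hHy.trans hH) hnn
      _ ≤ avC Fq (algebraMap (K Fq) (Kbar Fq) ξ - y) *
          (cc Fq ξ ^ n * absK Fq (evalK Fq (derivative P) ξ)) := by gcongr
      _ = cc Fq ξ ^ n * (avC Fq (algebraMap (K Fq) (Kbar Fq) ξ - y) *
          absK Fq (evalK Fq (derivative P) ξ)) := by ring
      _ ≤ _ := by gcongr

/-! ### The lower bound for the uniform exponent -/

lemma final_step {c q e u : ℝ} (hc : 1 ≤ c) (hq : 1 < q) (he : 0 ≤ e) (D : ℝ) (hD : 0 ≤ D) (hu : u < e) :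
    ∀ᶠ Y : ℝ in Filter.atTop, ∀ k : ℕ, Y < c * q ^ (k + 1) →
      D * (q ^ k) ^ (-e) < Y ^ (-u) := by
  have h := rpow_small (D * (c * q) ^ e) (e - u) 1 (by linarith) one_pos
  filter_upwards [h, Filter.eventually_gt_atTop 0] with Y hY hY0 k hk
  have hqk : 0 < q ^ k := by positivity
  have h1 : (q ^ k) ^ (-e) ≤ (c * q) ^ e * Y ^ (-e) := by
    rw [Real.rpow_neg hqk.le, Real.rpow_neg hY0.le, ← one_div, ← div_eq_mul_inv,
      div_le_div_iff₀ (by positivity) (by positivity), one_mul, ← Real.mul_rpow (by positivity) hqk.le]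
    apply Real.rpow_le_rpow hY0.le _ he
    rw [pow_succ] at hk
    linarith
  have h2 : Y ^ (-(e - u)) = Y ^ (-e) * Y ^ u := by
    rw [← Real.rpow_add hY0]; ring_nf
  rw [h2] at hY
  have h3 : Y ^ (-u) * Y ^ u = 1 := by rw [← Real.rpow_add hY0]; simp
  have h4 : 0 < Y ^ u := Real.rpow_pos_of_pos hY0 _
  have h5 : D * (q ^ k) ^ (-e) * Y ^ u < Y ^ (-u) * Y ^ u := by
    rw [h3]
    refine lt_of_le_of_lt ?_ hY
    calc _ ≤ D * ((c * q) ^ e * Y ^ (-e)) * Y ^ u := by gcongr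
      _ = _ := by ring
  exact lt_of_mul_lt_mul_right h5 h4.le

lemma exists_k {c q Y : ℝ} (hc : 1 ≤ c) (hq : 1 < q) (k0 : ℕ) (hY : c * q ^ (k0 + 1) ≤ Y) :
    ∃ k : ℕ, k0 ≤ k ∧ c * q ^ k ≤ Y ∧ Y < c * q ^ (k + 1) := by
  have hc0 : 0 < c := by linarith
  have h1 : 1 ≤ Y / c := by
    rw [le_div_iff₀ hc0]
    have : 1 ≤ q ^ (k0 + 1) := one_le_pow₀ hq.le
    nlinarith
  obtain ⟨k, hk1, hk2⟩ := exists_nat_pow_near h1 hq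
  rw [le_div_iff₀ hc0] at hk1
  rw [div_lt_iff₀ hc0] at hk2
  refine ⟨k, ?_, by linarith, by linarith⟩
  have h3 : q ^ (k0 + 1) < q ^ (k + 1) := by
    have : c * q ^ (k0 + 1) < c * q ^ (k + 1) := by linarith
    exact lt_of_mul_lt_mul_left this hc0.le
  have := (pow_lt_pow_iff_right₀ hq).1 h3
  omega

lemma hwnAt_of_lt_one {ξ : K Fq} {n : ℕ} (hn : 1 ≤ n) (hna : ¬ IsAlgDegLe Fq ξ n) {u : ℝ}
    (hu : u < 1) : u ∈ hwnAtSet Fq ξ n := by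
  have hc := cc_ge_one Fq ξ
  have hcn := one_le_pow₀ hc (n := n)
  have hq := card_gt_one Fq
  have hev := (final_step hcn hq zero_le_one (cc Fq ξ ^ n) (by linarith) hu).and
    (Filter.eventually_ge_atTop (cc Fq ξ ^ n * (Fintype.card Fq : ℝ) ^ (1 + 1)))
  obtain ⟨H0, hH0⟩ := Filter.eventually_atTop.1 hev
  refine ⟨H0, fun Y hY => ?_⟩
  obtain ⟨hY1, hY2⟩ := hH0 Y hY.le
  obtain ⟨k, hk1, hkY, hYk⟩ := exists_k hcn hq 1 hY2
  have hsum : ∑ i ∈ Finset.range n, (if i = 0 then k else 0) = k := by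
    rw [Finset.sum_ite_eq' (Finset.range n) 0 (fun _ => k), if_pos (by simp; omega)]
  obtain ⟨P, hPn, ⟨i, hi⟩, hdeg, hs⟩ := dirichlet Fq ξ n (k - 1) (fun i => if i = 0 then k else 0) (by
    rw [hsum]; omega)
  have hzero : ∀ i, P.coeff (i + 2) = 0 := by
    intro i
    by_cases h : i + 1 < n
    · have := hdeg (i + 1) h
      simpa using this
    · exact coeff_eq_zero_of_natDegree_lt (by omega)
  have ha1 : P.coeff 1 ≠ 0 := by
    rcases i with _ | i
    · exact hi
    · exact absurd (hzero i) hi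
  have hs2 : absK Fq (evalK Fq P ξ) ≤ ((Fintype.card Fq : ℝ) ^ k) ^ (-(1 : ℝ)) := by
    refine hs.trans (le_of_eq ?_)
    have : -(((k - 1 : ℕ) : ℤ) + 1) = -((k : ℕ) : ℤ) := by omega
    rw [this, Real.rpow_neg_one, zpow_neg, zpow_natCast]
  have hqk : 1 ≤ (Fintype.card Fq : ℝ) ^ k := one_le_pow₀ hq.le
  obtain ⟨α, h1, h2, h3, h4, h5⟩ := newtonD Fq hn hna hPn le_rfl
    (hs2.trans (Real.rpow_le_one_of_one_le_of_nonpos hqk (by norm_num)))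
    (fun i => by rw [hzero, map_zero, absK_zero])
    (by rw [mul_zero]; exact absK_pos Fq (emb_ne_zero Fq ha1))
  have hHge := HAbar_ge_one Fq h1
  refine ⟨α, h1, h2, ?_, h4, ?_⟩
  · refine h3.trans (le_trans ?_ hkY)
    have : absK Fq (emb Fq (P.coeff 1)) ≤ (Fintype.card Fq : ℝ) ^ k :=
      absK_emb_le_of_degree Fq (by have := hdeg 0 (by omega); simpa using this)
    gcongr
  · have h6 : absC Fq (algebraMap (K Fq) (Kbar Fq) ξ - α) * HAbar Fq α < Y ^ (-u) := by
      refine lt_of_le_of_lt (h5.trans ?_) (hY1 k hYk)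
      gcongr
    rw [inv_mul_eq_div, lt_div_iff₀ (by linarith)]
    exact h6

lemma hwnAt_of_finite {ξ : K Fq} {n : ℕ} (hn : 1 ≤ n) (hna : ¬ IsAlgDegLe Fq ξ n) {w' w u : ℝ}
    (hw' : (n : ℝ) ≤ w') (hww : w' < w) (hfin : w' ∉ wnSet Fq ξ n) (hu : u < w / (w - n + 1)) :
    u ∈ hwnAtSet Fq ξ n := by
  have hc := cc_ge_one Fq ξ
  have hcn := one_le_pow₀ hc (n := n)
  have hq := card_gt_one Fq
  have hq0 := card_pos' Fq
  set q : ℝ := ((Fintype.card Fq : ℕ) : ℝ) with hqdef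
  set c : ℝ := cc Fq ξ ^ n with hcdef
  have hn' : (1 : ℝ) ≤ n := by exact_mod_cast hn
  set D : ℝ := w - n + 1 with hDdef
  have hD : 1 ≤ D := by rw [hDdef]; linarith
  have hD0 : 0 < D := by linarith
  have hw0 : 0 < w := by linarith
  simp only [wnSet, Set.mem_setOf_eq, Set.not_infinite] at hfin
  obtain ⟨δ, hδ0, hδ1, hδ⟩ := pos_min _ hfin (fun P => absK Fq (evalK Fq P ξ)) (fun P hP => hP.2.1)
  have hev1 := (tendsto_qpow Fq).eventually (rpow_small 1 w δ hw0 hδ0)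
  have hev2 := (tendsto_qpow Fq).eventually
    (rpow_small ((c * c) ^ w') (w - w') 1 (by linarith) one_pos)
  obtain ⟨h0, hh0⟩ := Filter.eventually_atTop.1 (hev1.and hev2)
  let k0 : ℕ := ⌈D * h0⌉₊ + 1
  have hev := (final_step hcn hq (e := w / D) (by positivity) (c * q ^ (n - 1)) (by positivity) hu).and
    (Filter.eventually_ge_atTop (c * q ^ (k0 + 1)))
  obtain ⟨H0, hH0⟩ := Filter.eventually_atTop.1 hev
  refine ⟨H0, fun Y hY => ?_⟩
  obtain ⟨hY1, hY2⟩ := hH0 Y hY.le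
  obtain ⟨k, hk0, hkY, hYk⟩ := exists_k hcn hq k0 hY2
  set h : ℕ := ⌊(k : ℝ) / D⌋₊ with hdef
  have hhk : (h : ℝ) ≤ k / D := Nat.floor_le (by positivity)
  have hkh : (k : ℝ) / D < h + 1 := Nat.lt_floor_add_one _
  have hhh : h0 ≤ h := by
    apply Nat.le_floor
    rw [le_div_iff₀ hD0]
    have h1 : D * h0 ≤ ⌈D * h0⌉₊ := Nat.le_ceil _
    have h2 : (⌈D * h0⌉₊ : ℝ) ≤ k := by exact_mod_cast (by omega : ⌈D * h0⌉₊ ≤ k)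
    linarith
  have hhk' : h ≤ k := by
    have h1 : (h : ℝ) ≤ k := hhk.trans (div_le_self (by positivity) hD)
    exact_mod_cast h1
  have hsum : ∑ i ∈ Finset.range n, (if i = 0 then k else h) = k + (n - 1) * h := by
    obtain ⟨m, rfl⟩ : ∃ m, n = m + 1 := ⟨n - 1, by omega⟩
    rw [Finset.sum_range_succ']
    simp [add_comm]
  obtain ⟨P, hPn, ⟨i, hi⟩, hdeg, hs⟩ := dirichlet Fq ξ n (k + (n - 1) * h - 1)
    (fun i => if i = 0 then k else h) (by rw [hsum]; omega)
  have hP : P ≠ 0 := by rintro rfl; simp at hi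
  have hpos := absK_eval_pos Fq hna hP hPn
  have hs2 : absK Fq (evalK Fq P ξ) ≤ q ^ (-((k : ℝ) + (n - 1) * h)) := by
    refine hs.trans (le_of_eq ?_)
    have h1 : -(((k + (n - 1) * h - 1 : ℕ) : ℤ) + 1) = -((k + (n - 1) * h : ℕ) : ℤ) := by omega
    rw [h1, ← Real.rpow_intCast]
    congr 1
    push_cast [Nat.cast_sub hn]
    ring
  have hs1 : absK Fq (evalK Fq P ξ) ≤ 1 := by
    refine hs2.trans (Real.rpow_le_one_of_one_le_of_nonpos hq.le ?_)
    have : 0 ≤ ((n : ℝ) - 1) * h := mul_nonneg (by linarith) (by positivity)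
    have : (0 : ℝ) ≤ k := by positivity
    linarith
  have hcoef : ∀ i, absK Fq (emb Fq (P.coeff (i + 2))) ≤ q ^ h := by
    intro i
    by_cases hi : i + 1 < n
    · have := hdeg (i + 1) hi
      simp only [Nat.add_eq_zero_iff, one_ne_zero, and_false, if_false] at this
      exact absK_emb_le_of_degree Fq this
    · rw [coeff_eq_zero_of_natDegree_lt (by omega), map_zero, absK_zero]; positivity
  have hqh : 1 ≤ q ^ h := one_le_pow₀ hq.le
  have hqh0 : 0 < q ^ h := by linarith
  have hbig : c * q ^ h < absK Fq (emb Fq (P.coeff 1)) := by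
    by_contra! hle
    have hH : HP Fq P ≤ c * (c * q ^ h) := by
      apply HP_bound Fq ξ hP hn hPn (by nlinarith) hs1
      rintro (_ | i)
      · exact hle
      · refine (hcoef i).trans ?_
        nlinarith
    have hwh : absK Fq (evalK Fq P ξ) ≤ (q ^ h) ^ (-w) := by
      refine hs2.trans ?_
      rw [← Real.rpow_natCast, ← Real.rpow_mul hq0.le]
      apply Real.rpow_le_rpow_of_exponent_le hq.le
      rw [le_div_iff₀ hD0] at hhk
      rw [hDdef] at hhk
      nlinarith
    obtain ⟨hA, hB⟩ := hh0 h hhh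
    have hmem : absK Fq (evalK Fq P ξ) < HP Fq P ^ (-w') := by
      refine lt_of_le_of_lt hwh (lt_of_lt_of_le ?_
        (Real.rpow_le_rpow_of_nonpos (HP_pos Fq P) hH (by linarith)))
      rw [← mul_assoc, Real.mul_rpow (by positivity) hqh0.le, Real.rpow_neg (by positivity) w',
        ← one_div, div_mul_eq_mul_div, one_mul, lt_div_iff₀ (by positivity)]
      have h1 : (q ^ h) ^ (-w) = (q ^ h) ^ (-(w - w')) * (q ^ h) ^ (-w') := by
        rw [← Real.rpow_add hqh0]; ring_nf
      rw [h1]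
      have h2 : 0 < (q ^ h) ^ (-w') := by positivity
      calc _ = ((c * c) ^ w' * (q ^ h) ^ (-(w - w'))) * (q ^ h) ^ (-w') := by ring
        _ < 1 * (q ^ h) ^ (-w') := by gcongr
        _ = _ := one_mul _
    have h3 := hδ P ⟨hPn, hpos, hmem⟩
    rw [one_mul] at hA
    linarith
  obtain ⟨α, h1, h2, h3, h4, h5⟩ := newtonD Fq hn hna hPn hqh0.le hs1 hcoef hbig
  have hHge := HAbar_ge_one Fq h1
  refine ⟨α, h1, h2, ?_, h4, ?_⟩
  · refine h3.trans (le_trans ?_ hkY)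
    have : absK Fq (emb Fq (P.coeff 1)) ≤ (Fintype.card Fq : ℝ) ^ k :=
      absK_emb_le_of_degree Fq (by have := hdeg 0 (by omega); simpa using this)
    gcongr
  · have h6 : absC Fq (algebraMap (K Fq) (Kbar Fq) ξ - α) * HAbar Fq α < Y ^ (-u) := by
      refine lt_of_le_of_lt (h5.trans ?_) (hY1 k hYk)
      rw [mul_assoc]
      apply mul_le_mul_of_nonneg_left _ (by linarith)
      refine hs2.trans ?_
      rw [← Real.rpow_natCast, ← Real.rpow_natCast, ← Real.rpow_mul hq0.le, ← Real.rpow_add hq0]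
      apply Real.rpow_le_rpow_of_exponent_le hq.le
      rw [Nat.cast_sub hn]
      have h7 : (k : ℝ) * (w / D) = k + (n - 1) * (k / D) := by
        field_simp
        rw [hDdef]; ring
      have h8 : ((n : ℝ) - 1) * (k / D) ≤ (n - 1) * (h + 1) :=
        mul_le_mul_of_nonneg_left hkh.le (by linarith)
      push_cast
      nlinarith
    rw [inv_mul_eq_div, lt_div_iff₀ (by linarith)]
    exact h6

/-! ### Elementary inequalities for the double product -/

/-- One row of the double product. -/
def row (a : ℝ) (t : Multiset ℝ) : ℝ := (t.map fun b => max a b).prod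

/-- All entries lie in the unit interval. -/
def UI (s : Multiset ℝ) : Prop := ∀ a ∈ s, 0 ≤ a ∧ a ≤ 1

lemma UI.cons {a : ℝ} {s : Multiset ℝ} (h : UI (a ::ₘ s)) : (0 ≤ a ∧ a ≤ 1) ∧ UI s :=
  ⟨h a (by simp), fun b hb => h b (by simp [hb])⟩

lemma UI.prod_nonneg {s : Multiset ℝ} (h : UI s) : 0 ≤ s.prod :=
  Multiset.prod_nonneg fun a ha => (h a ha).1

lemma UI.prod_le_one {s : Multiset ℝ} (h : UI s) : s.prod ≤ 1 := by
  induction s using Multiset.induction_on with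
  | empty => simp
  | cons a s ih =>
    rw [Multiset.prod_cons]
    exact mul_le_one₀ h.cons.1.2 h.cons.2.prod_nonneg (ih h.cons.2)

lemma UI.row {a : ℝ} {t : Multiset ℝ} (ha : 0 ≤ a ∧ a ≤ 1) (ht : UI t) :
    UI (t.map fun b => max a b) := by
  intro x hx
  obtain ⟨b, hb, rfl⟩ := Multiset.mem_map.1 hx
  exact ⟨le_max_of_le_left ha.1, max_le ha.2 (ht b hb).2⟩

lemma row_nonneg {a : ℝ} {t : Multiset ℝ} (ha : 0 ≤ a ∧ a ≤ 1) (ht : UI t) : 0 ≤ row a t :=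
  (UI.row ha ht).prod_nonneg

lemma row_le_one {a : ℝ} {t : Multiset ℝ} (ha : 0 ≤ a ∧ a ≤ 1) (ht : UI t) : row a t ≤ 1 :=
  (UI.row ha ht).prod_le_one

lemma row_eq {a : ℝ} {t : Multiset ℝ} (h : ∀ b ∈ t, a ≤ b) : row a t = t.prod := by
  unfold row
  congr 1
  conv_rhs => rw [← Multiset.map_id' t]
  exact Multiset.map_congr rfl fun b hb => max_eq_right (h b hb)

lemma row_cons (a b : ℝ) (t : Multiset ℝ) : row a (b ::ₘ t) = max a b * row a t := by
  simp [row]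

lemma RR_cons (a : ℝ) (s t : Multiset ℝ) : RR (a ::ₘ s) t = row a t * RR s t := by
  simp [RR, row]

lemma RR_comm (s t : Multiset ℝ) : RR s t = RR t s := by
  unfold RR
  rw [Multiset.prod_map_prod_map]
  simp only [max_comm]

lemma RR_UI {s t : Multiset ℝ} (hs : UI s) (ht : UI t) :
    UI (s.map fun a => (t.map fun b => max a b).prod) := by
  intro x hx
  obtain ⟨a, ha, rfl⟩ := Multiset.mem_map.1 hx
  exact ⟨row_nonneg (hs a ha) ht, row_le_one (hs a ha) ht⟩

lemma RR_nonneg {s t : Multiset ℝ} (hs : UI s) (ht : UI t) : 0 ≤ RR s t := (RR_UI hs ht).prod_nonneg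

lemma RR_le_one {s t : Multiset ℝ} (hs : UI s) (ht : UI t) : RR s t ≤ 1 := (RR_UI hs ht).prod_le_one

lemma RR_le_row {a : ℝ} {s t : Multiset ℝ} (hs : UI (a ::ₘ s)) (ht : UI t) :
    RR (a ::ₘ s) t ≤ row a t := by
  rw [RR_cons]
  exact mul_le_of_le_one_right (row_nonneg hs.cons.1 ht) (RR_le_one hs.cons.2 ht)

lemma RR_le_row2 {a a' : ℝ} {s t : Multiset ℝ} (hs : UI (a ::ₘ a' ::ₘ s)) (ht : UI t) :
    RR (a ::ₘ a' ::ₘ s) t ≤ row a t * row a' t := by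
  rw [RR_cons]
  exact mul_le_mul_of_nonneg_left (RR_le_row hs.cons.2 ht) (row_nonneg hs.cons.1 ht)

lemma RR_two {a a' : ℝ} {s t : Multiset ℝ} (hs : UI (a ::ₘ a' ::ₘ s)) (ht : UI t)
    (h : ∀ b ∈ t, a ≤ b) (h' : ∀ b ∈ t, a' ≤ b) : RR (a ::ₘ a' ::ₘ s) t ≤ t.prod ^ 2 := by
  refine (RR_le_row2 hs ht).trans (le_of_eq ?_)
  rw [row_eq h, row_eq h', sq]

lemma RR_four {a a' b : ℝ} {s t : Multiset ℝ} (hs : UI (a ::ₘ a' ::ₘ s)) (ht : UI (b ::ₘ b ::ₘ t))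
    (h : a ≤ b) (h' : a' ≤ b) : RR (a ::ₘ a' ::ₘ s) (b ::ₘ b ::ₘ t) ≤ b ^ 4 := by
  have key : ∀ x, 0 ≤ x ∧ x ≤ 1 → x ≤ b → row x (b ::ₘ b ::ₘ t) ≤ b ^ 2 := by
    intro x hx hxb
    rw [row_cons, row_cons, max_eq_right hxb]
    have := row_le_one hx ht.cons.2.cons.2
    have hb := ht.cons.1.1
    calc _ ≤ b * (b * 1) := by gcongr
      _ = _ := by ring
  refine (RR_le_row2 hs ht).trans ?_
  calc _ ≤ b ^ 2 * b ^ 2 := mul_le_mul (key a hs.cons.1 h) (key a' hs.cons.2.cons.1 h')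
        (row_nonneg hs.cons.2.cons.1 ht) (sq_nonneg _)
    _ = _ := by ring

lemma RR_one {a b : ℝ} {s t : Multiset ℝ} (hs : UI (a ::ₘ s)) (ht : UI (b ::ₘ b ::ₘ t))
    (h : a ≤ b) (h' : ∀ x ∈ s, b ≤ x) :
    RR (a ::ₘ s) (b ::ₘ b ::ₘ t) * a ^ 2 ≤ (b * (a ::ₘ s).prod) ^ 2 := by
  have h1 := RR_le_row2 ht hs
  rw [row_cons, max_eq_left h, row_eq h'] at h1
  rw [RR_comm, Multiset.prod_cons]
  calc _ ≤ (b * s.prod * (b * s.prod)) * a ^ 2 := by gcongr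
    _ = _ := by ring

lemma multA {a b : ℝ} {s t : Multiset ℝ} (hs : UI (a ::ₘ s)) (ht : UI (b ::ₘ t))
    (hab : a ≤ b) (hbt : ∀ x ∈ t, b ≤ x) (hbs : ∀ x ∈ s, b ≤ x) :
    a ≤ max (a ::ₘ s).prod (b ::ₘ t).prod ∨
    RR (a ::ₘ s) (b ::ₘ t) * a ^ 2 ≤ (a ::ₘ s).prod * (b ::ₘ t).prod *
      max (a ::ₘ s).prod (b ::ₘ t).prod := by
  by_cases hs0 : s = 0
  · left; subst hs0; apply le_max_of_le_left; simp
  by_cases ht0 : t = 0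
  · left; subst ht0; apply le_max_of_le_right; simpa using hab
  right
  have hs' := hs.cons.2
  have ht' := ht.cons.2
  have ha := hs.cons.1.1
  have hb := ht.cons.1.1
  have hps := hs'.prod_nonneg
  have hpt := ht'.prod_nonneg
  have hrow : row a (b ::ₘ t) = (b ::ₘ t).prod := row_eq (by
    intro x hx
    rcases Multiset.mem_cons.1 hx with rfl | hx
    · exact hab
    · exact hab.trans (hbt x hx))
  have hthird : RR s t * a ≤ max (a ::ₘ s).prod (b ::ₘ t).prod := by
    obtain ⟨x, hx, hxm⟩ := Multiset.exists_min_image id hs0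
    obtain ⟨y, hy, hym⟩ := Multiset.exists_min_image id ht0
    rcases le_total x y with hxy | hxy
    · apply le_max_of_le_right
      obtain ⟨s', rfl⟩ := Multiset.exists_cons_of_mem hx
      have h1 := RR_le_row hs' ht'
      rw [row_eq (fun z hz => hxy.trans (hym z hz))] at h1
      rw [Multiset.prod_cons]
      calc _ ≤ t.prod * b := by gcongr
        _ = _ := by ring
    · apply le_max_of_le_left
      obtain ⟨t', rfl⟩ := Multiset.exists_cons_of_mem hy
      have h1 := RR_le_row ht' hs'
      rw [row_eq (fun z hz => hxy.trans (hxm z hz))] at h1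
      rw [RR_comm, Multiset.prod_cons]
      calc _ ≤ s.prod * a := by gcongr
        _ = _ := by ring
  have hcol : RR s (b ::ₘ t) = s.prod * RR s t := by
    rw [RR_comm, RR_cons, row_eq hbs, RR_comm]
  rw [RR_cons, hrow, hcol]
  have h0 : 0 ≤ (b ::ₘ t).prod := ht.prod_nonneg
  calc _ = ((a * s.prod) * (b ::ₘ t).prod) * (RR s t * a) := by ring
    _ ≤ ((a * s.prod) * (b ::ₘ t).prod) * max (a ::ₘ s).prod (b ::ₘ t).prod := by gcongr
    _ = _ := by rw [Multiset.prod_cons (a := a)]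

/-! ### Approximation by elements of the base field -/

lemma UI_map (ξ : K Fq) (s : Multiset (Kbar Fq)) : UI (s.map (ff Fq ξ)) := by
  intro a ha
  obtain ⟨x, _, rfl⟩ := Multiset.mem_map.1 ha
  exact ⟨ff_nonneg Fq ξ x, min_le_left _ _⟩

lemma mem_range_of_unique {P : Polynomial (Polynomial Fq)} (hP : P ≠ 0) (ξ : K Fq) {x : Kbar Fq}
    (hx : x ∈ rt Fq P) (h : ∀ y ∈ (rt Fq P).erase x, ff Fq ξ x < ff Fq ξ y) :
    x ∈ Set.range (algebraMap (K Fq) (Kbar Fq)) := by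
  by_contra hxK
  obtain ⟨y, hy, hxy⟩ := Kmem Fq hP ξ hx hxK
  have h1 := h y hy
  have h2 : ff Fq ξ y = ff Fq ξ x := by
    change min 1 (avC Fq (algebraMap (K Fq) (Kbar Fq) ξ - y)) = min 1 (avC Fq (algebraMap (K Fq) (Kbar Fq) ξ - x))
    rw [hxy]
  linarith

lemma star_of_root {ξ : K Fq} {n : ℕ} (hna : ¬ IsAlgDegLe Fq ξ n) {P : Polynomial (Polynomial Fq)}
    (hP : P ≠ 0) (hn : P.natDegree ≤ n) {γ : Kbar Fq} (hγ : γ ∈ rt Fq P)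
    (hK : γ ∈ Set.range (algebraMap (K Fq) (Kbar Fq))) :
    ∃ x : K Fq, IsAlgK Fq x ∧ degA Fq x ≤ n ∧ 1 ≤ HA Fq x ∧ HA Fq x ≤ HP Fq P ∧
      HA Fq x = HAbar Fq γ ∧
      0 < absK Fq (ξ - x) ∧ absK Fq (ξ - x) = dd Fq ξ γ := by
  obtain ⟨x, rfl⟩ := hK
  rw [mem_rt Fq hP] at hγ
  have halg : IsAlgKbar Fq (algebraMap (K Fq) (Kbar Fq) x) := ⟨P, hP, hγ⟩
  refine ⟨x, (IsAlgKbar_algebraMap Fq x).1 halg, ?_, ?_, ?_, ?_, ?_, ?_⟩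
  · rw [← degAbar_algebraMap Fq x]
    exact (degAbar_le Fq hP hγ).trans hn
  · rw [← HAbar_algebraMap Fq x]
    exact HAbar_ge_one Fq halg
  · rw [← HAbar_algebraMap Fq x]
    exact HAbar_le Fq hP hγ
  · rw [← HAbar_algebraMap Fq x]
  · apply absK_pos
    intro h0
    have : ξ = x := sub_eq_zero.1 h0
    subst this
    apply hna
    refine ⟨P, hP, hn, ?_⟩
    rw [evalKbar_algebraMap] at hγ
    exact (map_eq_zero _).1 hγ
  · exact (absC_algebraMap_sub Fq ξ x).symm

lemma mem_wnstarSet {ξ : K Fq} {n : ℕ} {w : ℝ}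
    (h : ∀ ε > 0, ∃ x : K Fq, IsAlgK Fq x ∧ degA Fq x ≤ n ∧ 0 < absK Fq (ξ - x) ∧
      absK Fq (ξ - x) < ε ∧ absK Fq (ξ - x) < HA Fq x ^ (-w - 1)) : w ∈ wnstarSet Fq ξ n := by
  refine infinite_of_small _ (fun x => absK Fq (ξ - x)) (fun x hx => hx.2.2.1) ?_
  intro ε hε
  obtain ⟨x, h1, h2, h3, h4, h5⟩ := h ε hε
  exact ⟨x, ⟨h1, h2, h3, h5⟩, h4⟩

lemma stepA_sym (ξ : K Fq) {P Q : Polynomial (Polynomial Fq)} (hP : P ≠ 0)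
    (hQd : rt Fq Q ≠ 0) {x : Kbar Fq} (hx : x ∈ rt Fq P)
    (hxQ : ∀ y ∈ rt Fq Q, ff Fq ξ x ≤ ff Fq ξ y) :
    (RR ((rt Fq P).map (ff Fq ξ)) ((rt Fq Q).map (ff Fq ξ)) ≤ pp Fq ξ Q ^ 2) ∨
    (x ∈ Set.range (algebraMap (K Fq) (Kbar Fq)) ∧
      (ff Fq ξ x ≤ max (pp Fq ξ P) (pp Fq ξ Q) ∨
        RR ((rt Fq P).map (ff Fq ξ)) ((rt Fq Q).map (ff Fq ξ)) * ff Fq ξ x ^ 2 ≤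
          pp Fq ξ P * pp Fq ξ Q * max (pp Fq ξ P) (pp Fq ξ Q))) := by
  have hPU := UI_map Fq ξ (rt Fq P)
  have hQU := UI_map Fq ξ (rt Fq Q)
  obtain ⟨β, hβ, hβmin⟩ := Multiset.exists_min_image (ff Fq ξ) hQd
  have hPe : (rt Fq P).map (ff Fq ξ) = ff Fq ξ x ::ₘ ((rt Fq P).erase x).map (ff Fq ξ) := by
    rw [← Multiset.map_cons, Multiset.cons_erase hx]
  have hQe : (rt Fq Q).map (ff Fq ξ) = ff Fq ξ β ::ₘ ((rt Fq Q).erase β).map (ff Fq ξ) := by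
    rw [← Multiset.map_cons, Multiset.cons_erase hβ]
  by_cases hc : ∃ y ∈ (rt Fq P).erase x, ff Fq ξ y ≤ ff Fq ξ β
  · left
    obtain ⟨y, hy, hyβ⟩ := hc
    have hPe2 : (rt Fq P).map (ff Fq ξ) =
        ff Fq ξ x ::ₘ ff Fq ξ y ::ₘ (((rt Fq P).erase x).erase y).map (ff Fq ξ) := by
      rw [← Multiset.map_cons, ← Multiset.map_cons, Multiset.cons_erase hy, Multiset.cons_erase hx]
    rw [hPe2] at hPU ⊢
    refine RR_two hPU hQU ?_ ?_
    · intro b hb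
      obtain ⟨z, hz, rfl⟩ := Multiset.mem_map.1 hb
      exact hxQ z hz
    · intro b hb
      obtain ⟨z, hz, rfl⟩ := Multiset.mem_map.1 hb
      exact hyβ.trans (hβmin z hz)
  · right
    push Not at hc
    refine ⟨mem_range_of_unique Fq hP ξ hx (fun y hy => (hxQ β hβ).trans_lt (hc y hy)), ?_⟩
    unfold pp
    rw [hPe] at hPU ⊢
    rw [hQe] at hQU ⊢
    refine multA hPU hQU (hxQ β hβ) ?_ ?_
    · intro b hb
      obtain ⟨z, hz, rfl⟩ := Multiset.mem_map.1 hb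
      exact hβmin z (Multiset.mem_of_mem_erase hz)
    · intro b hb
      obtain ⟨z, hz, rfl⟩ := Multiset.mem_map.1 hb
      exact (hc z hz).le

lemma numA {m : ℕ} {G h x y c1 C1 R a : ℝ} (hG : 1 ≤ G) (h1 : 1 ≤ h) (hh : h ≤ G ^ 2)
    (hx0 : 0 ≤ x) (hy0 : 0 ≤ y) (ha0 : 0 ≤ a) (hc1 : 1 ≤ c1) (hC1 : 1 ≤ C1)
    (hx : x * G ^ (2 * m + 5) ≤ c1) (hy : y * G ^ (2 * m + 4) * h ≤ c1)
    (hR0 : 0 ≤ R) (hR : 1 ≤ C1 * (G ^ 2) ^ (m + 2) * h ^ (m + 2) * R) (hbig : C1 * c1 ^ 3 < G)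
    (halt : R ≤ y ^ 2 ∨ R ≤ x ^ 2 ∨ a ≤ max x y ∨ R * a ^ 2 ≤ x * y * max x y) :
    a * G ^ (m + 3) < 1 := by
  have hG0 : 0 < G := by linarith
  have hc1' : c1 ≤ c1 ^ 3 := le_self_pow₀ hc1 (by norm_num)
  have hc2' : c1 ^ 2 ≤ c1 ^ 3 := pow_le_pow_right₀ hc1 (by norm_num)
  have hb1 : C1 * c1 ^ 2 < G := lt_of_le_of_lt (by gcongr) hbig
  have hb2 : c1 < G := by nlinarith
  have hGG : G ≤ G ^ 2 := le_self_pow₀ hG (by norm_num)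
  have hG4 : G ≤ G ^ 4 := le_self_pow₀ hG (by norm_num)
  have hG3 : G ≤ G ^ 3 := le_self_pow₀ hG (by norm_num)
  set U := C1 * (G ^ 2) ^ (m + 2) * h ^ (m + 2) with hU
  have hU0 : 0 ≤ U := by positivity
  have hyG : y * G ^ (2 * m + 4) ≤ c1 :=
    le_trans (le_mul_of_one_le_right (by positivity) h1) hy
  have hxG : x * G ^ (2 * m + 4) ≤ c1 := by
    exact le_trans (mul_le_mul_of_nonneg_left (pow_le_pow_right₀ hG (by omega)) hx0) hx
  have hmax : max x y * G ^ (2 * m + 4) ≤ c1 := by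
    rcases max_choice x y with h | h <;> rw [h] <;> assumption
  rcases halt with h' | h' | h' | h'
  · exfalso
    have e1 : U * y ^ 2 * G ^ 4 ≤ C1 * (y * G ^ (2 * m + 4) * h) ^ 2 := by
      have : h ^ m ≤ (G ^ 2) ^ m := by gcongr
      calc U * y ^ 2 * G ^ 4 = C1 * G ^ (2 * m + 8) * y ^ 2 * h ^ 2 * h ^ m := by rw [hU]; ring
        _ ≤ C1 * G ^ (2 * m + 8) * y ^ 2 * h ^ 2 * (G ^ 2) ^ m := by gcongr
        _ = _ := by ring
    have e2 : C1 * (y * G ^ (2 * m + 4) * h) ^ 2 ≤ C1 * c1 ^ 2 := by gcongr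
    have e3 : 1 ≤ U * y ^ 2 := hR.trans (by gcongr)
    have e4 : G ^ 4 ≤ U * y ^ 2 * G ^ 4 := le_mul_of_one_le_left (by positivity) e3
    linarith
  · exfalso
    have e1 : U * x ^ 2 * G ^ 2 ≤ C1 * (x * G ^ (2 * m + 5)) ^ 2 := by
      have : h ^ (m + 2) ≤ (G ^ 2) ^ (m + 2) := by gcongr
      calc U * x ^ 2 * G ^ 2 = C1 * G ^ (2 * m + 6) * x ^ 2 * h ^ (m + 2) := by rw [hU]; ring
        _ ≤ C1 * G ^ (2 * m + 6) * x ^ 2 * (G ^ 2) ^ (m + 2) := by gcongr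
        _ = _ := by ring
    have e2 : C1 * (x * G ^ (2 * m + 5)) ^ 2 ≤ C1 * c1 ^ 2 := by gcongr
    have e3 : 1 ≤ U * x ^ 2 := hR.trans (by gcongr)
    have e4 : G ^ 2 ≤ U * x ^ 2 * G ^ 2 := le_mul_of_one_le_left (by positivity) e3
    linarith
  · have e1 : a * G ^ (2 * m + 4) ≤ c1 := le_trans (by gcongr) hmax
    have e2 : a * G ^ (m + 3) * G ≤ a * G ^ (2 * m + 4) := by
      rw [mul_assoc, ← pow_succ]
      exact mul_le_mul_of_nonneg_left (pow_le_pow_right₀ hG (by omega)) ha0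
    by_contra hcon
    push Not at hcon
    nlinarith
  · have e0 : U * (x * y) * G ^ 3 ≤ C1 * ((x * G ^ (2 * m + 5)) * (y * G ^ (2 * m + 4) * h)) := by
      have : h ^ (m + 1) ≤ (G ^ 2) ^ (m + 1) := by gcongr
      calc U * (x * y) * G ^ 3 = C1 * G ^ (2 * m + 7) * x * y * h * h ^ (m + 1) := by rw [hU]; ring
        _ ≤ C1 * G ^ (2 * m + 7) * x * y * h * (G ^ 2) ^ (m + 1) := by gcongr
        _ = _ := by ring
    have e1 : U * (x * y) * G ^ 3 ≤ C1 * (c1 * c1) := e0.trans (by gcongr)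
    have e2 : a ^ 2 ≤ U * (x * y) * max x y := by
      calc a ^ 2 ≤ (U * R) * a ^ 2 := le_mul_of_one_le_left (by positivity) hR
        _ = U * (R * a ^ 2) := by ring
        _ ≤ U * (x * y * max x y) := by gcongr
        _ = _ := by ring
    have e3 : (a * G ^ (m + 3)) ^ 2 * G ≤ C1 * c1 ^ 3 := by
      have hm0 : 0 ≤ max x y := le_max_of_le_left hx0
      calc (a * G ^ (m + 3)) ^ 2 * G = a ^ 2 * (G ^ 3 * G ^ (2 * m + 4)) := by ring
        _ ≤ (U * (x * y) * max x y) * (G ^ 3 * G ^ (2 * m + 4)) := by gcongr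
        _ = (U * (x * y) * G ^ 3) * (max x y * G ^ (2 * m + 4)) := by ring
        _ ≤ (C1 * (c1 * c1)) * c1 := by gcongr
        _ = _ := by ring
    by_contra hcon
    push Not at hcon
    have : 1 ≤ (a * G ^ (m + 3)) ^ 2 := one_le_pow₀ hcon
    nlinarith

lemma lt_rpow_helper {a H h θ : ℝ} (h1 : 1 ≤ h) (hH : h ≤ H) (hθ : 0 ≤ θ) (ha : a * H ^ θ < 1) :
    a < h ^ (-θ) := by
  have hH0 : 0 < H := by linarith
  have h2 : a < H ^ (-θ) := by
    rw [Real.rpow_neg hH0.le, ← one_div, lt_div_iff₀ (by positivity)]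
    exact ha
  exact h2.trans_le (Real.rpow_le_rpow_of_nonpos (by linarith) hH (by linarith))

lemma dd_of_ff_lt {ξ : K Fq} {x : Kbar Fq} (h : ff Fq ξ x < 1) : dd Fq ξ x = ff Fq ξ x := by
  unfold ff at h ⊢
  rcases min_lt_iff.1 h with h | h
  · exact absurd h (lt_irrefl _)
  · rw [min_eq_right h.le]

lemma ppG (ξ : K Fq) {m : ℕ} {P : Polynomial (Polynomial Fq)} (hP : P ≠ 0)
    (hn : P.natDegree ≤ m + 2) {G : ℝ} (hG : 0 < G) (hGH : HP Fq P = G ^ 2)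
    (hs : absK Fq (evalK Fq P ξ) < HP Fq P ^ (-((m : ℝ) + 3 / 2))) :
    pp Fq ξ P * G ^ (2 * m + 5) ≤ cc Fq ξ ^ (m + 2) := by
  have h1 := pp_le Fq ξ hP hn
  have hc : 1 ≤ cc Fq ξ ^ (m + 2) := one_le_pow₀ (cc_ge_one Fq ξ)
  have h2 : absK Fq (evalK Fq P ξ) * G ^ (2 * m + 3) ≤ 1 := by
    have e : (G ^ 2) ^ (-((m : ℝ) + 3 / 2)) = (G ^ (2 * m + 3))⁻¹ := by
      rw [← Real.rpow_natCast G 2, ← Real.rpow_mul hG.le, ← Real.rpow_natCast G (2 * m + 3),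
        ← Real.rpow_neg hG.le]
      congr 1
      push_cast
      ring
    rw [hGH, e] at hs
    calc _ ≤ (G ^ (2 * m + 3))⁻¹ * G ^ (2 * m + 3) := by gcongr
      _ = 1 := inv_mul_cancel₀ (by positivity)
  calc pp Fq ξ P * G ^ (2 * m + 5) = (pp Fq ξ P * HP Fq P) * G ^ (2 * m + 3) := by rw [hGH]; ring
    _ ≤ (cc Fq ξ ^ (m + 2) * absK Fq (evalK Fq P ξ)) * G ^ (2 * m + 3) := by gcongr
    _ = cc Fq ξ ^ (m + 2) * (absK Fq (evalK Fq P ξ) * G ^ (2 * m + 3)) := by ring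
    _ ≤ cc Fq ξ ^ (m + 2) * 1 := by gcongr
    _ = _ := mul_one _

lemma half_mem {ξ : K Fq} {m : ℕ} (hna : ¬ IsAlgDegLe Fq ξ (m + 2)) :
    (((m : ℝ) + 1) / 2) ∈ wnstarSet Fq ξ (m + 2) := by
  have hq := card_gt_one Fq
  set q : ℝ := ((Fintype.card Fq : ℕ) : ℝ) with hqdef
  set c : ℝ := cc Fq ξ ^ (m + 2) with hcdef
  have hc : 1 ≤ c := one_le_pow₀ (cc_ge_one Fq ξ)
  set D : ℝ := (2 * c * q) ^ (m + 2) with hD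
  have hD1 : 1 ≤ D := one_le_pow₀ (by nlinarith)
  set c1 : ℝ := c * D with hc1def
  have hc1 : 1 ≤ c1 := one_le_mul_of_one_le_of_one_le hc hD1
  have hcc1 : c ≤ c1 := le_mul_of_one_le_right (by linarith) hD1
  set C1 : ℝ := c ^ (2 * (m + 2)) with hC1def
  have hC1 : 1 ≤ C1 := one_le_pow₀ hc
  apply mem_wnstarSet
  intro ε hε
  set G0 : ℝ := C1 * c1 ^ 3 + 1 / ε with hG0
  have hp1 : 1 ≤ C1 * c1 ^ 3 := one_le_mul_of_one_le_of_one_le hC1 (one_le_pow₀ hc1)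
  have hp2 : 0 < 1 / ε := by positivity
  obtain ⟨P, hPi, hPn, hPd, hPH, hPs⟩ := exists_irreducible_small Fq (n := m + 2) (by omega) hna
    (v := (m : ℝ) + 3 / 2) (by positivity) (by push_cast; linarith)
    (max (G0 ^ 2) (2 * (c * q ^ (1 + 1))))
  have hP0 := hPi.ne_zero
  set H := HP Fq P with hHdef
  have hH0 : 0 < H := HP_pos Fq P
  set G := Real.sqrt H with hGdef
  have hGH : H = G ^ 2 := (Real.sq_sqrt hH0.le).symm
  have hGbig : G0 < G := Real.lt_sqrt_of_sq_lt ((le_max_left _ _).trans_lt hPH)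
  have hG1 : 1 ≤ G := by linarith
  have hG0' : 0 < G := by linarith
  obtain ⟨k, hk1, hkY, hYk⟩ := exists_k (Y := H / 2) hc hq 1 (by
    have := (le_max_right _ _).trans_lt hPH
    exact (le_div_iff₀' two_pos).2 this.le)
  obtain ⟨Q, hQ0, hQn, hQH, hQs⟩ := dir_simple Fq ξ (n := m + 2) (by omega) hk1
  have hqk : 1 < q ^ k := one_lt_pow₀ hq (by omega)
  have hQlt : HP Fq Q < H := by
    have := hQH.trans hkY
    linarith
  have hPQ : ¬ P ∣ Q := fun hdvd => absurd (HP_le_of_dvd Fq hQ0 hdvd) (not_le.2 hQlt)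
  have hQd : 0 < Q.natDegree := by
    rcases Nat.eq_zero_or_pos Q.natDegree with h | h
    · exfalso
      have h1 := one_le_absK_of_const Fq (ξ := ξ) hQ0 h
      have h2 : (q ^ k) ^ (-((m + 2 : ℕ) : ℝ)) < 1 :=
        Real.rpow_lt_one_of_one_lt_of_neg hqk (by push_cast; linarith [(Nat.cast_nonneg m : (0:ℝ) ≤ m)])
      linarith
    · exact h
  have hres := resultant_bound' Fq ξ hPi hPd hQ0 hPQ hPn hQn
  have hx := (ppG Fq ξ hP0 hPn hG0' hGH hPs).trans hcc1
  have hy : pp Fq ξ Q * G ^ (2 * m + 4) * HP Fq Q ≤ c1 := by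
    have h1 := pp_le Fq ξ hQ0 hQn
    have h2 : absK Fq (evalK Fq Q ξ) * H ^ (m + 2) ≤ D := by
      rw [Real.rpow_neg (by positivity), Real.rpow_natCast] at hQs
      have h3 : H ≤ 2 * c * q * q ^ k := by
        rw [pow_succ] at hYk
        linarith
      calc _ ≤ ((q ^ k) ^ (m + 2))⁻¹ * (2 * c * q * q ^ k) ^ (m + 2) := by gcongr
        _ = D * (((q ^ k) ^ (m + 2))⁻¹ * (q ^ k) ^ (m + 2)) := by rw [hD, mul_pow (2 * c * q)]; ring
        _ = D := by rw [inv_mul_cancel₀ (by positivity), mul_one]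
    calc _ = (pp Fq ξ Q * HP Fq Q) * H ^ (m + 2) := by rw [hGH]; ring
      _ ≤ (c * absK Fq (evalK Fq Q ξ)) * H ^ (m + 2) := by gcongr
      _ = c * (absK Fq (evalK Fq Q ξ) * H ^ (m + 2)) := by ring
      _ ≤ c * D := by gcongr
  have hRR0 := RR_nonneg (UI_map Fq ξ (rt Fq P)) (UI_map Fq ξ (rt Fq Q))
  set R := RR ((rt Fq P).map (ff Fq ξ)) ((rt Fq Q).map (ff Fq ξ)) with hRdef
  have hres' : 1 ≤ C1 * (G ^ 2) ^ (m + 2) * HP Fq Q ^ (m + 2) * R := by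
    rw [← hGH]; exact hres
  have hhG : HP Fq Q ≤ G ^ 2 := by rw [← hGH]; exact hQlt.le
  have hnum : ∀ a : ℝ, 0 ≤ a → (R ≤ pp Fq ξ Q ^ 2 ∨ R ≤ pp Fq ξ P ^ 2 ∨
      a ≤ max (pp Fq ξ P) (pp Fq ξ Q) ∨
      R * a ^ 2 ≤ pp Fq ξ P * pp Fq ξ Q * max (pp Fq ξ P) (pp Fq ξ Q)) → a * G ^ (m + 3) < 1 :=
    fun a ha halt => numA hG1 (HP_ge_one Fq Q) hhG (pp_nonneg Fq ξ P) (pp_nonneg Fq ξ Q)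
      ha hc1 hC1 hx hy hRR0 hres' (by linarith) halt
  have hnot : ¬ (1 * G ^ (m + 3) < 1) := by
    rw [one_mul, not_lt]; exact one_le_pow₀ hG1
  have fin : ∀ (S : Polynomial (Polynomial Fq)), S ≠ 0 → S.natDegree ≤ m + 2 → HP Fq S ≤ H →
      ∀ γ ∈ rt Fq S, γ ∈ Set.range (algebraMap (K Fq) (Kbar Fq)) → ff Fq ξ γ * G ^ (m + 3) < 1 →
      ∃ x : K Fq, IsAlgK Fq x ∧ degA Fq x ≤ m + 2 ∧ 0 < absK Fq (ξ - x) ∧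
      absK Fq (ξ - x) < ε ∧ absK Fq (ξ - x) < HA Fq x ^ (-(((m : ℝ) + 1) / 2) - 1) := by
    intro S hS0 hSn hSH γ hγ hγK hγs
    obtain ⟨x, h1, h2, h3, h4, -, h5, h6⟩ := star_of_root Fq hna hS0 hSn hγ hγK
    have hf0 := ff_nonneg Fq ξ γ
    have hle : ff Fq ξ γ * G ≤ ff Fq ξ γ * G ^ (m + 3) :=
      mul_le_mul_of_nonneg_left (le_self_pow₀ hG1 (by omega)) hf0
    have hlt1 : ff Fq ξ γ < 1 := by nlinarith
    rw [dd_of_ff_lt Fq hlt1] at h6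
    refine ⟨x, h1, h2, h5, ?_, ?_⟩
    · rw [h6]
      have h7 : 1 < ε * G := by
        have : 1 / ε < G := by linarith
        rwa [div_lt_iff₀ hε, mul_comm] at this
      exact lt_of_mul_lt_mul_right (by linarith) hG0'.le
    · rw [h6]
      have e : -(((m : ℝ) + 1) / 2) - 1 = -(((m : ℝ) + 3) / 2) := by ring
      rw [e]
      refine lt_rpow_helper h3 (h4.trans hSH) (by positivity) ?_
      have e2 : H ^ (((m : ℝ) + 3) / 2) = G ^ (m + 3) := by
        rw [hGH, ← Real.rpow_natCast G 2, ← Real.rpow_mul hG0'.le, ← Real.rpow_natCast G (m + 3)]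
        congr 1
        push_cast
        ring
      rw [e2]
      exact hγs
  have hrP : rt Fq P ≠ 0 := by
    rw [← Multiset.card_pos, card_rt]; exact hPd
  have hrQ : rt Fq Q ≠ 0 := by
    rw [← Multiset.card_pos, card_rt]; exact hQd
  obtain ⟨γ, hγ, hmin⟩ := Multiset.exists_min_image (ff Fq ξ) (s := rt Fq P + rt Fq Q) (by
    intro h
    rw [← Multiset.card_eq_zero, Multiset.card_add, card_rt] at h
    omega)
  rcases Multiset.mem_add.1 hγ with hγ' | hγ'
  · rcases stepA_sym Fq ξ hP0 hrQ hγ' (fun y hy => hmin y (Multiset.mem_add.2 (Or.inr hy))) with h | ⟨hK, h⟩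
    · exact absurd (hnum 1 zero_le_one (Or.inl h)) hnot
    · exact fin P hP0 hPn le_rfl γ hγ' hK (hnum _ (ff_nonneg Fq ξ γ) (Or.inr (Or.inr h)))
  · have := stepA_sym Fq ξ hQ0 hrP hγ' (fun y hy => hmin y (Multiset.mem_add.2 (Or.inl hy)))
    rw [RR_comm, max_comm, mul_comm (pp Fq ξ Q)] at this
    rcases this with h | ⟨hK, h⟩
    · exact absurd (hnum 1 zero_le_one (Or.inr (Or.inl h))) hnot
    · exact fin Q hQ0 hQn hQlt.le γ hγ' hK (hnum _ (ff_nonneg Fq ξ γ) (Or.inr (Or.inr h)))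

lemma numB {m : ℕ} {G h x b Z c1 c2 C1 R a : ℝ} (hG : 1 ≤ G) (h1 : 1 ≤ h) (hh : h ≤ G ^ 2)
    (hx0 : 0 ≤ x) (hb0 : 0 ≤ b) (hZ0 : 0 ≤ Z) (ha0 : 0 ≤ a) (hc1 : 0 ≤ c1) (hC1 : 0 ≤ C1)
    (hx : x * G ^ (2 * m + 5) ≤ c1) (hb : b * h * Z ≤ c2)
    (hR0 : 0 ≤ R) (hR : 1 ≤ C1 * (G ^ 2) ^ (m + 2) * h ^ (m + 2) * R)
    (hbig1 : C1 * c1 ^ 2 < G ^ 2) (hbig2 : C1 * c2 ^ 2 * c1 ^ 2 < G ^ 2)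
    (hbig3 : C1 * c2 ^ 4 * (G ^ 2) ^ (2 * m + 2) < Z ^ 4)
    (halt : R ≤ b ^ 4 ∨ R ≤ x ^ 2 ∨ R * a ^ 2 ≤ (b * x) ^ 2) :
    a * (Z * G ^ 2) < 1 := by
  have hG0 : 0 < G := by linarith
  have hbhz : 0 ≤ b * h * Z := by positivity
  have hc2 : 0 ≤ c2 := hbhz.trans hb
  set U := C1 * (G ^ 2) ^ (m + 2) * h ^ (m + 2) with hU
  have hU0 : 0 ≤ U := by positivity
  have hhm : h ^ m ≤ (G ^ 2) ^ m := by gcongr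
  have hhm2 : h ^ (m + 2) ≤ (G ^ 2) ^ (m + 2) := by gcongr
  have hh24 : h ^ 2 ≤ h ^ 4 := pow_le_pow_right₀ h1 (by norm_num)
  rcases halt with h' | h' | h'
  · exfalso
    have e1 : U * b ^ 4 * Z ^ 4 ≤ C1 * c2 ^ 4 * (G ^ 2) ^ (2 * m + 2) := by
      calc U * b ^ 4 * Z ^ 4 = C1 * (G ^ 2) ^ (m + 2) * (b ^ 4 * Z ^ 4) * (h ^ m * h ^ 2) := by
            rw [hU]; ring
        _ ≤ C1 * (G ^ 2) ^ (m + 2) * (b ^ 4 * Z ^ 4) * ((G ^ 2) ^ m * h ^ 4) := by gcongr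
        _ = C1 * (b * h * Z) ^ 4 * (G ^ 2) ^ (2 * m + 2) := by ring
        _ ≤ _ := by gcongr
    have e3 : 1 ≤ U * b ^ 4 := hR.trans (by gcongr)
    have e4 : Z ^ 4 ≤ U * b ^ 4 * Z ^ 4 := le_mul_of_one_le_left (by positivity) e3
    linarith
  · exfalso
    have e1 : U * x ^ 2 * G ^ 2 ≤ C1 * c1 ^ 2 := by
      calc U * x ^ 2 * G ^ 2 = C1 * G ^ (2 * m + 6) * x ^ 2 * h ^ (m + 2) := by rw [hU]; ring
        _ ≤ C1 * G ^ (2 * m + 6) * x ^ 2 * (G ^ 2) ^ (m + 2) := by gcongr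
        _ = C1 * (x * G ^ (2 * m + 5)) ^ 2 := by ring
        _ ≤ _ := by gcongr
    have e3 : 1 ≤ U * x ^ 2 := hR.trans (by gcongr)
    have e4 : G ^ 2 ≤ U * x ^ 2 * G ^ 2 := le_mul_of_one_le_left (by positivity) e3
    linarith
  · have e2 : a ^ 2 ≤ U * (b * x) ^ 2 := by
      calc a ^ 2 ≤ (U * R) * a ^ 2 := le_mul_of_one_le_left (by positivity) hR
        _ = U * (R * a ^ 2) := by ring
        _ ≤ _ := by gcongr
    have e3 : (a * (Z * G ^ 2)) ^ 2 * G ^ 2 ≤ C1 * c2 ^ 2 * c1 ^ 2 := by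
      calc (a * (Z * G ^ 2)) ^ 2 * G ^ 2 = a ^ 2 * (Z ^ 2 * G ^ 6) := by ring
        _ ≤ (U * (b * x) ^ 2) * (Z ^ 2 * G ^ 6) := by gcongr
        _ = C1 * G ^ (2 * m + 10) * x ^ 2 * (b * h * Z) ^ 2 * h ^ m := by rw [hU]; ring
        _ ≤ C1 * G ^ (2 * m + 10) * x ^ 2 * c2 ^ 2 * (G ^ 2) ^ m := by gcongr
        _ = C1 * c2 ^ 2 * (x * G ^ (2 * m + 5)) ^ 2 := by ring
        _ ≤ _ := by gcongr
    by_contra hcon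
    push Not at hcon
    have : 1 ≤ (a * (Z * G ^ 2)) ^ 2 := one_le_pow₀ hcon
    have hG2 : 0 < G ^ 2 := by positivity
    nlinarith

/-- Approximants coming from the uniform exponent which lie in the base field. -/
lemma good_of_range {ξ : K Fq} {n : ℕ} (hna : ¬ IsAlgDegLe Fq ξ n) {w Y ε : ℝ} (hw : 0 ≤ w)
    (hYε : Y ^ (-w) < ε) {Q : Polynomial (Polynomial Fq)} (hQ : Irreducible Q)
    (hQn : Q.natDegree ≤ n) {α : Kbar Fq} (hα : evalKbar Fq Q α = 0) (hHY : HP Fq Q ≤ Y)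
    (hlt : dd Fq ξ α < (HP Fq Q)⁻¹ * Y ^ (-w)) (hK : α ∈ Set.range (algebraMap (K Fq) (Kbar Fq))) :
    ∃ x : K Fq, IsAlgK Fq x ∧ degA Fq x ≤ n ∧ 0 < absK Fq (ξ - x) ∧
      absK Fq (ξ - x) < ε ∧ absK Fq (ξ - x) < HA Fq x ^ (-w - 1) := by
  obtain ⟨x, h1, h2, h3, -, h4, h5, h6⟩ := star_of_root Fq hna hQ.ne_zero hQn
    ((mem_rt Fq hQ.ne_zero).2 hα) hK
  have hh := HP_ge_one Fq Q
  have hh0 := HP_pos Fq Q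
  have hY0 : 0 < Y := by linarith
  have hYp : 0 < Y ^ (-w) := Real.rpow_pos_of_pos hY0 _
  refine ⟨x, h1, h2, h5, ?_, ?_⟩
  · rw [h6]
    have : (HP Fq Q)⁻¹ ≤ 1 := inv_le_one_of_one_le₀ hh
    have : (HP Fq Q)⁻¹ * Y ^ (-w) ≤ 1 * Y ^ (-w) := by gcongr
    linarith
  · rw [h6, h4, HAbar_eq Fq hQ hα]
    refine hlt.trans_le ?_
    have e : HP Fq Q ^ (-w - 1) = (HP Fq Q)⁻¹ * HP Fq Q ^ (-w) := by
      rw [Real.rpow_sub hh0, Real.rpow_one, inv_mul_eq_div]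
    rw [e]
    have : Y ^ (-w) ≤ HP Fq Q ^ (-w) := Real.rpow_le_rpow_of_nonpos hh0 hHY (by linarith)
    gcongr

lemma uniform_approx {ξ : K Fq} {n : ℕ} {w Y : ℝ}
    (h : ∃ α : Kbar Fq, IsAlgKbar Fq α ∧ degAbar Fq α ≤ n ∧
      HAbar Fq α ≤ Y ∧ 0 < absC Fq (algebraMap (K Fq) (Kbar Fq) ξ - α) ∧
      absC Fq (algebraMap (K Fq) (Kbar Fq) ξ - α) < (HAbar Fq α)⁻¹ * Y ^ (-w)) :
    ∃ (α : Kbar Fq) (Q : Polynomial (Polynomial Fq)), Irreducible Q ∧ evalKbar Fq Q α = 0 ∧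
      Q.natDegree ≤ n ∧ HP Fq Q ≤ Y ∧ dd Fq ξ α < (HP Fq Q)⁻¹ * Y ^ (-w) := by
  obtain ⟨α, h1, h2, h3, h4, h5⟩ := h
  obtain ⟨Q, hQ, hα⟩ := exists_irreducible_kill Fq h1
  rw [HAbar_eq Fq hQ hα] at h3 h5
  rw [degAbar_eq Fq hQ hα] at h2
  rw [← avC_apply] at h5
  exact ⟨α, Q, hQ, hα, h2, h3, h5⟩

lemma stepB_one {ξ : K Fq} (hna : ¬ IsAlgDegLe Fq ξ 1) {w : ℝ} (hw : 0 < w)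
    (hm : w ∈ hwnAtSet Fq ξ 1) : w ∈ wnstarSet Fq ξ 1 := by
  obtain ⟨H0, hH0⟩ := hm
  apply mem_wnstarSet
  intro ε hε
  obtain ⟨Y, hY1, hY2⟩ := ((rpow_small 1 w ε hw hε).and (Filter.eventually_gt_atTop H0)).exists
  rw [one_mul] at hY1
  obtain ⟨α, Q, hQ, hα, hQn, hQY, hlt⟩ := uniform_approx Fq (hH0 Y hY2)
  refine good_of_range Fq hna hw.le hY1 hQ hQn hα hQY hlt ?_
  have hαr := (mem_rt Fq hQ.ne_zero).2 hα
  apply mem_range_of_unique Fq hQ.ne_zero ξ hαr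
  intro y hy
  exfalso
  have hc : Multiset.card ((rt Fq Q).erase α) = 0 := by
    rw [Multiset.card_erase_of_mem hαr, card_rt, Nat.pred_eq_sub_one]
    omega
  rw [Multiset.card_eq_zero] at hc
  rw [hc] at hy
  simp at hy

lemma stepB {ξ : K Fq} {m : ℕ} (hna : ¬ IsAlgDegLe Fq ξ (m + 2)) {w : ℝ}
    (hw : ((m : ℝ) + 1) / 2 < w)
    (hm : w ∈ hwnAtSet Fq ξ (m + 2)) : w ∈ wnstarSet Fq ξ (m + 2) := by
  have hw0 : 0 < w := lt_of_le_of_lt (by positivity) hw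
  obtain ⟨H0, hH0⟩ := hm
  apply mem_wnstarSet
  intro ε hε
  set c : ℝ := cc Fq ξ ^ (m + 2) with hcdef
  have hc : 1 ≤ c := one_le_pow₀ (cc_ge_one Fq ξ)
  set C1 : ℝ := c ^ (2 * (m + 2)) with hC1def
  have hC1 : 1 ≤ C1 := one_le_pow₀ hc
  set c2 : ℝ := 2 ^ w with hc2def
  have ev1 := rpow_small c2 w ε hw0 hε
  have ev2 := rpow_small (C1 * c2 ^ 4) (4 * w - (2 * m + 2)) 1 (by linarith) one_pos
  have ev3 := rpow_small 1 (w + 1) ε (by linarith) hε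
  obtain ⟨B, hB⟩ := Filter.eventually_atTop.1 ((ev1.and ev2).and (ev3.and
    ((Filter.eventually_gt_atTop (2 * H0)).and ((Filter.eventually_gt_atTop (C1 * c ^ 2)).and
    (Filter.eventually_gt_atTop (C1 * c2 ^ 2 * c ^ 2))))))
  obtain ⟨P, hPi, hPn, hPd, hPH, hPs⟩ := exists_irreducible_small Fq (n := m + 2) (by omega) hna
    (v := (m : ℝ) + 3 / 2) (by positivity) (by push_cast; linarith) B
  obtain ⟨⟨hb1, hb2⟩, hb3, hb4, hb5, hb6⟩ := hB _ hPH.le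
  have hP0 := hPi.ne_zero
  have hH1 : 1 ≤ HP Fq P := HP_ge_one Fq P
  set H := HP Fq P with hHdef
  have hH0' : 0 < H := by linarith
  set G := Real.sqrt H with hGdef
  have hGH : H = G ^ 2 := (Real.sq_sqrt hH0'.le).symm
  have hG1 : 1 ≤ G := Real.one_le_sqrt.2 hH1
  have hG0' : 0 < G := by linarith
  have hx := ppG Fq ξ hP0 hPn hG0' hGH hPs
  set Z := H ^ w with hZdef
  have hZ0 : 0 < Z := Real.rpow_pos_of_pos hH0' _
  have hHw : (H / 2) ^ (-w) = c2 * H ^ (-w) := by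
    rw [Real.div_rpow hH0'.le (by norm_num), Real.rpow_neg (by norm_num : (0:ℝ) ≤ 2)]
    simp [div_eq_mul_inv, mul_comm, hc2def]
  have hZi : H ^ (-w) = Z⁻¹ := Real.rpow_neg hH0'.le _
  obtain ⟨α, Q, hQ, hα, hQn, hQY, hlt⟩ := uniform_approx Fq (hH0 (H / 2) (by linarith))
  by_cases hK : α ∈ Set.range (algebraMap (K Fq) (Kbar Fq))
  · exact good_of_range Fq hna hw0.le (by rw [hHw]; exact hb1) hQ hQn hα hQY hlt hK
  have hαr := (mem_rt Fq hQ.ne_zero).2 hα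
  obtain ⟨α', hα', hαα⟩ := Kmem Fq hQ.ne_zero ξ hαr hK
  have hff : ff Fq ξ α' = ff Fq ξ α := by
    change min 1 (avC Fq (algebraMap (K Fq) (Kbar Fq) ξ - α')) = min 1 (avC Fq (algebraMap (K Fq) (Kbar Fq) ξ - α))
    rw [hαα]
  set b := ff Fq ξ α with hbdef
  have hb0 : 0 ≤ b := ff_nonneg Fq ξ α
  have hh0 := HP_pos Fq Q
  have hbb : b * HP Fq Q * Z ≤ c2 := by
    have h1 : b ≤ dd Fq ξ α := min_le_right _ _
    rw [hHw, hZi] at hlt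
    calc b * HP Fq Q * Z ≤ ((HP Fq Q)⁻¹ * (c2 * Z⁻¹)) * HP Fq Q * Z := by
          gcongr; exact h1.trans hlt.le
      _ = c2 := by field_simp
  have hQlt : HP Fq Q < H := by linarith
  have hPQ : ¬ P ∣ Q := fun hdvd => absurd (HP_le_of_dvd Fq hQ.ne_zero hdvd) (not_le.2 hQlt)
  have hres := resultant_bound' Fq ξ hPi hPd hQ.ne_zero hPQ hPn hQn
  have hPU := UI_map Fq ξ (rt Fq P)
  have hQU := UI_map Fq ξ (rt Fq Q)
  have hQe : (rt Fq Q).map (ff Fq ξ) =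
      b ::ₘ b ::ₘ (((rt Fq Q).erase α).erase α').map (ff Fq ξ) := by
    have : b ::ₘ b ::ₘ (((rt Fq Q).erase α).erase α').map (ff Fq ξ) =
      ff Fq ξ α ::ₘ ff Fq ξ α' ::ₘ (((rt Fq Q).erase α).erase α').map (ff Fq ξ) := by rw [hff]
    rw [this, ← Multiset.map_cons, ← Multiset.map_cons, Multiset.cons_erase hα',
      Multiset.cons_erase hαr]
  have hRR0 := RR_nonneg hPU hQU
  set R := RR ((rt Fq P).map (ff Fq ξ)) ((rt Fq Q).map (ff Fq ξ)) with hRdef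
  have hres' : 1 ≤ C1 * (G ^ 2) ^ (m + 2) * HP Fq Q ^ (m + 2) * R := by
    rw [← hGH]; exact hres
  have hZ4 : C1 * c2 ^ 4 * (G ^ 2) ^ (2 * m + 2) < Z ^ 4 := by
    rw [← hGH]
    have e : H ^ (-(4 * w - (2 * (m : ℝ) + 2))) = H ^ (2 * m + 2) / Z ^ 4 := by
      rw [hZdef, ← Real.rpow_natCast (H ^ w) 4, ← Real.rpow_mul hH0'.le,
        ← Real.rpow_natCast H (2 * m + 2), ← Real.rpow_sub hH0']
      congr 1
      push_cast
      ring
    rw [e, ← mul_div_assoc, div_lt_one (by positivity)] at hb2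
    exact hb2
  have hnum : ∀ a : ℝ, 0 ≤ a → (R ≤ b ^ 4 ∨ R ≤ pp Fq ξ P ^ 2 ∨
      R * a ^ 2 ≤ (b * pp Fq ξ P) ^ 2) → a * (Z * G ^ 2) < 1 :=
    fun a ha halt => numB hG1 (HP_ge_one Fq Q) (by rw [← hGH]; exact hQlt.le) (pp_nonneg Fq ξ P)
      hb0 hZ0.le ha (by linarith) (by linarith) hx hbb hRR0 hres' (by rw [← hGH]; exact hb5)
      (by rw [← hGH]; exact hb6) hZ4 halt
  have hZ1 : 1 ≤ Z := Real.one_le_rpow hH1 hw0.le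
  have hZG1 : 1 ≤ Z * G ^ 2 := one_le_mul_of_one_le_of_one_le hZ1 (one_le_pow₀ hG1)
  have hnot : ¬ (1 * (Z * G ^ 2) < 1) := by
    rw [one_mul, not_lt]; exact hZG1
  by_cases hx1 : ∃ x ∈ rt Fq P, ff Fq ξ x ≤ b
  swap
  · exfalso
    push Not at hx1
    refine hnot (hnum 1 zero_le_one (Or.inr (Or.inl ?_)))
    rw [hRdef, RR_comm]
    rw [hQe] at hQU ⊢
    have hall : ∀ y ∈ (rt Fq P).map (ff Fq ξ), b ≤ y := by
      intro y hy
      obtain ⟨z, hz, rfl⟩ := Multiset.mem_map.1 hy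
      exact (hx1 z hz).le
    exact RR_two hQU hPU hall hall
  obtain ⟨x, hxr, hxb⟩ := hx1
  by_cases hy1 : ∃ y ∈ (rt Fq P).erase x, ff Fq ξ y ≤ b
  · exfalso
    obtain ⟨y, hyr, hyb⟩ := hy1
    refine hnot (hnum 1 zero_le_one (Or.inl ?_))
    have hPe2 : (rt Fq P).map (ff Fq ξ) =
        ff Fq ξ x ::ₘ ff Fq ξ y ::ₘ (((rt Fq P).erase x).erase y).map (ff Fq ξ) := by
      rw [← Multiset.map_cons, ← Multiset.map_cons, Multiset.cons_erase hyr, Multiset.cons_erase hxr]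
    rw [hRdef]
    rw [hPe2] at hPU ⊢
    rw [hQe] at hQU ⊢
    exact RR_four hPU hQU hxb hyb
  push Not at hy1
  have hxK := mem_range_of_unique Fq hP0 ξ hxr (fun y hy => hxb.trans_lt (hy1 y hy))
  have hPe : (rt Fq P).map (ff Fq ξ) = ff Fq ξ x ::ₘ ((rt Fq P).erase x).map (ff Fq ξ) := by
    rw [← Multiset.map_cons, Multiset.cons_erase hxr]
  have hf0 := ff_nonneg Fq ξ x
  have hfin : ff Fq ξ x * (Z * G ^ 2) < 1 := by
    refine hnum _ hf0 (Or.inr (Or.inr ?_))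
    rw [hRdef, pp]
    rw [hPe] at hPU ⊢
    rw [hQe] at hQU ⊢
    refine RR_one hPU hQU hxb ?_
    intro y hy
    obtain ⟨z, hz, rfl⟩ := Multiset.mem_map.1 hy
    exact (hy1 z hz).le
  have hff1 : ff Fq ξ x < 1 := by nlinarith
  obtain ⟨γ, h1, h2, h3, h4, -, h5, h6⟩ := star_of_root Fq hna hP0 hPn hxr hxK
  rw [dd_of_ff_lt Fq hff1] at h6
  have hZH : H ^ (w + 1) = Z * G ^ 2 := by
    rw [Real.rpow_add hH0', Real.rpow_one, ← hGH]
  rw [← hZH] at hfin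
  refine ⟨γ, h1, h2, h5, ?_, ?_⟩
  · rw [h6]
    rw [one_mul] at hb3
    exact (lt_rpow_helper hH1 le_rfl (by linarith) hfin).trans hb3
  · rw [h6]
    have e : -w - 1 = -(w + 1) := by ring
    rw [e]
    exact lt_rpow_helper h3 h4 (by linarith) hfin

lemma coe_le_of_forall_lt {r : ℝ} {x : EReal} (h : ∀ u : ℝ, u < r → (u : EReal) ≤ x) :
    (r : EReal) ≤ x := by
  by_contra hlt
  push Not at hlt
  obtain ⟨u, hu1, hu2⟩ := EReal.lt_iff_exists_real_btwn.1 hlt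
  exact absurd (h u (EReal.coe_lt_coe_iff.1 hu2)) (not_le.2 hu1)

lemma first_ineq {ξ : K Fq} {n : ℕ} (hn : 1 ≤ n) (hna : ¬ IsAlgDegLe Fq ξ n) :
    hwnAt Fq ξ n ≤ wnstar Fq ξ n := by
  by_contra hlt
  push Not at hlt
  have key : ∀ w : ℝ, w ∈ hwnAtSet Fq ξ n → 0 < w → ¬ (wnstar Fq ξ n < (w : EReal)) := by
    intro w hw hw0 hlt
    apply absurd _ (not_le.2 hlt)
    rcases Nat.lt_or_ge n 2 with h2 | h2
    · obtain rfl : n = 1 := by omega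
      exact le_sSup ⟨w, stepB_one Fq hna hw0 hw, rfl⟩
    · obtain ⟨m, rfl⟩ : ∃ m, n = m + 2 := ⟨n - 2, by omega⟩
      have h3 : (((((m : ℝ) + 1) / 2 : ℝ)) : EReal) ≤ wnstar Fq ξ (m + 2) :=
        le_sSup ⟨_, half_mem Fq hna, rfl⟩
      have h4 : ((m : ℝ) + 1) / 2 < w := EReal.coe_lt_coe_iff.1 (h3.trans_lt hlt)
      exact le_sSup ⟨w, stepB Fq hna h4 hw, rfl⟩
  obtain ⟨_, ⟨w, hw, rfl⟩, hlt2⟩ := lt_sSup_iff.1 hlt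
  by_cases hw0 : 0 < w
  · exact key w hw hw0 hlt2
  · push Not at hw0
    refine key (1 / 2) (hwnAt_of_lt_one Fq hn hna (by norm_num)) (by norm_num) ?_
    refine hlt2.trans_le ?_
    exact EReal.coe_le_coe_iff.2 (by linarith)

lemma second_ineq {ξ : K Fq} {n : ℕ} (hn : 1 ≤ n) (hna : ¬ IsAlgDegLe Fq ξ n) :
    (if wn Fq ξ n = ⊤ then (1 : EReal)
      else (((wn Fq ξ n).toReal / ((wn Fq ξ n).toReal - n + 1) : ℝ) : EReal))
      ≤ hwnAt Fq ξ n := by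
  split_ifs with htop
  · have : ((1 : ℝ) : EReal) ≤ hwnAt Fq ξ n :=
      coe_le_of_forall_lt (fun u hu => le_sSup ⟨u, hwnAt_of_lt_one Fq hn hna hu, rfl⟩)
    simpa using this
  · have hge : (((n : ℝ)) : EReal) ≤ wn Fq ξ n := by
      refine coe_le_of_forall_lt (fun u hu => ?_)
      have h1 : ((max u 0 : ℝ) : EReal) ≤ wn Fq ξ n :=
        le_sSup ⟨max u 0, mem_wnSet Fq hn hna (le_max_right _ _)
          (max_lt hu (by exact_mod_cast hn)), rfl⟩
      exact (EReal.coe_le_coe_iff.2 (le_max_left _ _)).trans h1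
    have hbot : wn Fq ξ n ≠ ⊥ := by
      intro h
      rw [h] at hge
      exact absurd hge (not_le.2 (EReal.bot_lt_coe _))
    obtain ⟨r, hr⟩ : ∃ r : ℝ, wn Fq ξ n = (r : EReal) := ⟨_, (EReal.coe_toReal htop hbot).symm⟩
    rw [hr, EReal.toReal_coe]
    rw [hr] at hge
    have hnr : (n : ℝ) ≤ r := EReal.coe_le_coe_iff.1 hge
    refine coe_le_of_forall_lt (fun u hu => ?_)
    have hcont : ContinuousAt (fun w : ℝ => w / (w - n + 1)) r := by
      apply ContinuousAt.div continuousAt_id (by fun_prop)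
      linarith
    have hev : ∀ᶠ w in nhds r, u < w / (w - n + 1) := hcont.eventually (lt_mem_nhds hu)
    have hev2 : ∀ᶠ w in nhdsWithin r (Set.Ioi r), u < w / (w - n + 1) :=
      hev.filter_mono nhdsWithin_le_nhds
    obtain ⟨w, hw1, hw2⟩ := (hev2.and self_mem_nhdsWithin).exists
    have hw2' : r < w := hw2
    refine le_sSup ⟨u, hwnAt_of_finite Fq hn hna (w' := (r + w) / 2) (w := w) (by linarith)
      (by linarith) ?_ hw1, rfl⟩
    intro hmem
    have h1 : (((r + w) / 2 : ℝ) : EReal) ≤ wn Fq ξ n := le_sSup ⟨_, hmem, rfl⟩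
    rw [hr, EReal.coe_le_coe_iff] at h1
    linarith

/-- `w_n^*(ξ) ≥ ŵ_n^@(ξ) ≥ w_n(ξ)/(w_n(ξ) - n + 1)`, the right-hand
side being interpreted as `1` when `w_n(ξ) = ∞`. -/
theorem wirsing_at (Fq : Type) [Field Fq] [Fintype Fq]
    (n : ℕ) (hn : 1 ≤ n) (ξ : K Fq) (hnotalg : ¬ IsAlgDegLe Fq ξ n) :
    hwnAt Fq ξ n ≤ wnstar Fq ξ n ∧
    (if wn Fq ξ n = ⊤ then (1 : EReal)
      else (((wn Fq ξ n).toReal / ((wn Fq ξ n).toReal - n + 1) : ℝ) : EReal))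
      ≤ hwnAt Fq ξ n := by
  exact ⟨first_ineq Fq hn hnotalg, second_ineq Fq hn hnotalg⟩

end
end MahlerKoksmaFq
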